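/- arXiv:2110.08099 — 7 statements merged into one kernel-verified Lean document; each statement's English description precedes it below -/
import Mathlib

section
/- Let φ ∈ X, let φ̃(r) := ∫₀^r |φ'(s)| ds, define φ^±(r) := ½(φ̃(r) ± φ(r)) for r ≥ 0 and φ^±(r) := ±½ φ(0) for r < 0, and for ε > 0 set φ_ε(r) := φ⁺(r+ε) − φ⁻(r−ε). Then φ_ε ∈ X, φ(r) ≤ φ_ε(r) for all r ≥ 0, and ∫₀^∞ (φ_ε(r) − φ(r)) dr ≤ 2ε‖φ‖_X. -/
open MeasureTheory Metric Set intervalIntegral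

noncomputable section

/-- The class `X`: continuous functions on `[0,∞)` whose derivative is continuous
up to a finite number of jumps. -/
def MemX (φ : ℝ → ℝ) : Prop :=
  ContinuousOn φ (Set.Ici 0) ∧
  ∃ J : Finset ℝ, (∀ x ∈ Set.Ici (0:ℝ) \ (J : Set ℝ), DifferentiableAt ℝ φ x) ∧
    ContinuousOn (deriv φ) (Set.Ici 0 \ (J : Set ℝ))

/-- The norm `‖φ‖_X = ∫₀^∞ |φ'(r)| dr`. -/
def normX (φ : ℝ → ℝ) : ℝ := ∫ r in Set.Ioi (0:ℝ), |deriv φ r|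

/-- `φ̃(r) = ∫₀^r |φ'(s)| ds`. -/
def phiTilde (φ : ℝ → ℝ) (r : ℝ) : ℝ := ∫ s in (0:ℝ)..r, |deriv φ s|

/-- `φ⁺(r) = ½(φ̃(r) + φ(r))` for `r ≥ 0`, `φ⁺(r) = ½φ(0)` for `r < 0`. -/
def phiPlus (φ : ℝ → ℝ) (r : ℝ) : ℝ :=
  if 0 ≤ r then (phiTilde φ r + φ r) / 2 else φ 0 / 2

/-- `φ⁻(r) = ½(φ̃(r) − φ(r))` for `r ≥ 0`, `φ⁻(r) = −½φ(0)` for `r < 0`. -/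
def phiMinus (φ : ℝ → ℝ) (r : ℝ) : ℝ :=
  if 0 ≤ r then (phiTilde φ r - φ r) / 2 else -(φ 0) / 2

/-- `φ_ε(r) = φ⁺(r+ε) − φ⁻(r−ε)`. -/
def phiEps (φ : ℝ → ℝ) (ε : ℝ) (r : ℝ) : ℝ := phiPlus φ (r + ε) - phiMinus φ (r - ε)

theorem MemX.neg {φ : ℝ → ℝ} (hφ : MemX φ) : MemX (-φ) := by
  obtain ⟨hc, J, hd, hdc⟩ := hφ
  refine ⟨hc.neg, J, fun x hx => (hd x hx).neg, ?_⟩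
  rw [deriv.neg']
  exact hdc.neg

theorem normX_neg (φ : ℝ → ℝ) : normX (-φ) = normX φ := by
  simp [normX, deriv.neg']

theorem phiMinus_eq_phiPlus_neg (φ : ℝ → ℝ) : phiMinus φ = phiPlus (-φ) := by
  ext r
  simp [phiMinus, phiPlus, phiTilde, deriv.neg', sub_eq_add_neg]

theorem intervalIntegrable_abs_deriv {φ : ℝ → ℝ}
    (hint : IntegrableOn (fun r => |deriv φ r|) (Ioi 0)) {a b : ℝ} (ha : 0 ≤ a) (hb : 0 ≤ b) :
    IntervalIntegrable (fun r => |deriv φ r|) volume a b := by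
  rw [intervalIntegrable_iff]
  exact hint.mono_set fun x hx => lt_of_le_of_lt (le_min ha hb) hx.1

theorem intervalIntegrable_deriv {φ : ℝ → ℝ}
    (hint : IntegrableOn (fun r => |deriv φ r|) (Ioi 0)) {a b : ℝ} (ha : 0 ≤ a) (hb : 0 ≤ b) :
    IntervalIntegrable (deriv φ) volume a b := by
  have h := intervalIntegrable_abs_deriv hint ha hb
  rw [intervalIntegrable_iff] at h ⊢
  exact (integrable_norm_iff (measurable_deriv φ).aestronglyMeasurable).1 h

theorem phiTilde_sub {φ : ℝ → ℝ} (hint : IntegrableOn (fun r => |deriv φ r|) (Ioi 0))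
    {a b : ℝ} (ha : 0 ≤ a) (hb : 0 ≤ b) :
    phiTilde φ b - phiTilde φ a = ∫ s in a..b, |deriv φ s| :=
  integral_interval_sub_left (intervalIntegrable_abs_deriv hint le_rfl hb)
    (intervalIntegrable_abs_deriv hint le_rfl ha)

theorem phiTilde_sub_le_normX {φ : ℝ → ℝ}
    (hint : IntegrableOn (fun r => |deriv φ r|) (Ioi 0)) {a b : ℝ} (ha : 0 ≤ a) (hab : a ≤ b) :
    phiTilde φ b - phiTilde φ a ≤ normX φ := by
  rw [phiTilde_sub hint ha (ha.trans hab), integral_of_le hab, normX]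
  exact setIntegral_mono_set hint (.of_forall fun _ => abs_nonneg _)
    (LE.le.eventuallyLE fun x hx => lt_of_le_of_lt ha hx.1)

theorem MemX.abs_sub_le {φ : ℝ → ℝ} (hφ : MemX φ)
    (hint : IntegrableOn (fun r => |deriv φ r|) (Ioi 0)) {a b : ℝ} (ha : 0 ≤ a) (hab : a ≤ b) :
    |φ b - φ a| ≤ phiTilde φ b - phiTilde φ a := by
  obtain ⟨hc, J, hd, -⟩ := hφ
  have hb := ha.trans hab
  rw [phiTilde_sub hint ha hb, ← integral_eq_of_hasDerivAt_off_countable φ (deriv φ)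
    J.countable_toSet (hc.mono fun x hx => ?_) (fun x hx => (hd x ⟨?_, hx.2⟩).hasDerivAt)
    (intervalIntegrable_deriv hint ha hb)]
  · exact abs_integral_le_integral_abs hab
  · exact (le_min ha hb).trans hx.1
  · exact (le_min ha hb).trans hx.1.1.le

theorem phiPlus_eq_max (φ : ℝ → ℝ) (r : ℝ) :
    phiPlus φ r = (phiTilde φ (max r 0) + φ (max r 0)) / 2 := by
  unfold phiPlus
  split_ifs with h
  · rw [max_eq_left h]
  · rw [max_eq_right (not_le.1 h).le]
    simp [phiTilde]

theorem MemX.continuous_phiPlus {φ : ℝ → ℝ} (hφ : MemX φ)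
    (hint : IntegrableOn (fun r => |deriv φ r|) (Ioi 0)) : Continuous (phiPlus φ) := by
  have hpos : ∀ r : ℝ, max r 0 ∈ Ici (0 : ℝ) := fun r => le_max_right r 0
  have hmax : Continuous fun r : ℝ => max r 0 := by fun_prop
  have ht : ContinuousOn (phiTilde φ) (Ici 0) := fun x hx => by
    have hx1 : (0 : ℝ) ≤ x + 1 := add_nonneg hx zero_le_one
    have h := continuousOn_primitive_interval (μ := volume) (a := 0) (b := x + 1)
      (f := fun s => |deriv φ s|) (by
        rw [uIcc_of_le hx1, integrableOn_Icc_iff_integrableOn_Ioc]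
        exact hint.mono_set fun y hy => hy.1)
    rw [uIcc_of_le hx1] at h
    refine (h x ⟨hx, by linarith⟩).mono_of_mem_nhdsWithin ?_
    rw [← Ici_inter_Iic]
    exact Filter.inter_mem self_mem_nhdsWithin
      (mem_nhdsWithin_of_mem_nhds (Iic_mem_nhds (by linarith)))
  rw [funext (phiPlus_eq_max φ)]
  exact ((ht.comp_continuous hmax hpos).add (hφ.1.comp_continuous hmax hpos)).div_const 2

theorem MemX.monotone_phiPlus {φ : ℝ → ℝ} (hφ : MemX φ)
    (hint : IntegrableOn (fun r => |deriv φ r|) (Ioi 0)) : Monotone (phiPlus φ) := by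
  intro a b hab
  have h := neg_le_of_abs_le
    (hφ.abs_sub_le hint (le_max_right a 0) (max_le_max_right 0 hab))
  rw [phiPlus_eq_max, phiPlus_eq_max]
  linarith

theorem MemX.phiPlus_sub_le {φ : ℝ → ℝ} (hφ : MemX φ)
    (hint : IntegrableOn (fun r => |deriv φ r|) (Ioi 0)) {a b : ℝ} (hab : a ≤ b) :
    phiPlus φ b - phiPlus φ a ≤ normX φ := by
  have hmax := max_le_max_right 0 hab
  have h := le_of_abs_le (hφ.abs_sub_le hint (le_max_right a 0) hmax)
  have h' := phiTilde_sub_le_normX hint (le_max_right a 0) hmax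
  rw [phiPlus_eq_max, phiPlus_eq_max]
  linarith

/-- Off a finite set, `φ⁺` is differentiable with continuous derivative. -/
theorem MemX.exists_finset_phiPlus {φ : ℝ → ℝ} (hφ : MemX φ)
    (hint : IntegrableOn (fun r => |deriv φ r|) (Ioi 0)) :
    ∃ J : Finset ℝ, ∀ x ∉ J, DifferentiableAt ℝ (phiPlus φ) x ∧
      ContinuousAt (deriv (phiPlus φ)) x := by
  obtain ⟨hc, J, hd, hdc⟩ := hφ
  refine ⟨insert 0 J, fun x hx => ?_⟩
  rw [Finset.mem_insert, not_or] at hx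
  rcases lt_or_gt_of_ne hx.1 with h0 | h0
  · have hev : phiPlus φ =ᶠ[nhds x] fun _ => φ 0 / 2 := by
      filter_upwards [Iio_mem_nhds h0] with y hy
      exact if_neg (not_le.2 hy)
    refine ⟨hev.differentiableAt_iff.2 (differentiableAt_const _), ?_⟩
    rw [continuousAt_congr hev.deriv]
    simpa using continuousAt_const
  · have hU : IsOpen (Ioi (0 : ℝ) \ (J : Set ℝ)) := isOpen_Ioi.sdiff J.finite_toSet.isClosed
    have hsub : Ioi (0 : ℝ) \ (J : Set ℝ) ⊆ Ici 0 \ (J : Set ℝ) :=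
      sdiff_subset_sdiff_left Ioi_subset_Ici_self
    have hxU : x ∈ Ioi (0 : ℝ) \ (J : Set ℝ) := ⟨h0, hx.2⟩
    have hcont : ∀ y ∈ Ioi (0 : ℝ) \ (J : Set ℝ), ContinuousAt (deriv φ) y := fun y hy =>
      (hdc.mono hsub).continuousAt (hU.mem_nhds hy)
    have hder : ∀ y ∈ Ioi (0 : ℝ) \ (J : Set ℝ),
        HasDerivAt (phiPlus φ) ((|deriv φ y| + deriv φ y) / 2) y := fun y hy => by
      have ht : HasDerivAt (phiTilde φ) |deriv φ y| y :=
        integral_hasDerivAt_right (intervalIntegrable_abs_deriv hint le_rfl (le_of_lt hy.1))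
          (measurable_deriv φ).abs.stronglyMeasurable.stronglyMeasurableAtFilter
          (hcont y hy).abs
      refine ((ht.add (hd y (hsub hy)).hasDerivAt).div_const 2).congr_of_eventuallyEq ?_
      filter_upwards [Ioi_mem_nhds hy.1] with z hz
      exact if_pos (le_of_lt hz)
    refine ⟨(hder x hxU).differentiableAt, ?_⟩
    have hev : deriv (phiPlus φ) =ᶠ[nhds x] fun y => (|deriv φ y| + deriv φ y) / 2 := by
      filter_upwards [hU.mem_nhds hxU] with y hy
      exact (hder y hy).deriv
    rw [continuousAt_congr hev]
    exact ((hcont x hxU).abs.add (hcont x hxU)).div_const 2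

theorem memX_phiEps {φ : ℝ → ℝ} (hφ : MemX φ)
    (hint : IntegrableOn (fun r => |deriv φ r|) (Ioi 0)) (ε : ℝ) : MemX (phiEps φ ε) := by
  have hint' : IntegrableOn (fun r => |deriv (-φ) r|) (Ioi 0) := by simpa [deriv.neg'] using hint
  have hcm := hφ.neg.continuous_phiPlus hint'
  have hcp := hφ.continuous_phiPlus hint
  obtain ⟨K, hK⟩ := hφ.exists_finset_phiPlus hint
  obtain ⟨L, hL⟩ := hφ.neg.exists_finset_phiPlus hint'
  rw [← phiMinus_eq_phiPlus_neg] at hL hcm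
  have hcont : Continuous (phiEps φ ε) :=
    (hcp.comp (continuous_add_const ε)).sub (hcm.comp (continuous_sub_right ε))
  set M : Finset ℝ := K.image (· - ε) ∪ L.image (· + ε)
  have hMK : ∀ x, x ∉ M → x + ε ∉ K := fun x hx h =>
    hx (Finset.mem_union_left _ (Finset.mem_image.2 ⟨x + ε, h, by simp⟩))
  have hML : ∀ x, x ∉ M → x - ε ∉ L := fun x hx h =>
    hx (Finset.mem_union_right _ (Finset.mem_image.2 ⟨x - ε, h, by simp⟩))
  have hder : ∀ x ∉ M, HasDerivAt (phiEps φ ε)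
      (deriv (phiPlus φ) (x + ε) - deriv (phiMinus φ) (x - ε)) x := fun x hx =>
    ((hK _ (hMK x hx)).1.hasDerivAt.comp_add_const x ε).sub
      ((hL _ (hML x hx)).1.hasDerivAt.comp_sub_const x ε)
  refine ⟨hcont.continuousOn, M, fun x hx => (hder x hx.2).differentiableAt, ?_⟩
  refine ContinuousOn.congr (fun x hx => ContinuousAt.continuousWithinAt ?_)
    (fun x hx => (hder x hx.2).deriv)
  exact ((hK _ (hMK x hx.2)).2.comp (f := fun y => y + ε) (by fun_prop)).sub
    ((hL _ (hML x hx.2)).2.comp (f := fun y => y - ε) (by fun_prop))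

/-- If the increments of a continuous function are at most `N`, the integral over `[0, R]` of its
increments of length `ε` is at most `ε N`. -/
theorem integral_shift_sub_le {g : ℝ → ℝ} (hg : Continuous g) {N : ℝ}
    (hN : ∀ a b, a ≤ b → g b - g a ≤ N) {ε R : ℝ} (hε : 0 ≤ ε) (hR : 0 ≤ R) :
    ∫ r in (0 : ℝ)..R, (g (r + ε) - g r) ≤ ε * N := by
  have hi : ∀ a b, IntervalIntegrable g volume a b := hg.intervalIntegrable
  have hgε : Continuous fun r => g (r + ε) := by fun_prop
  have hgR : Continuous fun r => g (r + R) := by fun_prop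
  have h : ∫ r in (0 : ℝ)..R, (g (r + ε) - g r) = ∫ s in (0 : ℝ)..ε, (g (s + R) - g s) := by
    rw [integral_sub (hgε.intervalIntegrable _ _) (hi _ _),
      integral_sub (hgR.intervalIntegrable _ _) (hi _ _), integral_comp_add_right,
      integral_comp_add_right, zero_add, zero_add, add_comm ε R]
    have h₁ := integral_add_adjacent_intervals (hi 0 ε) (hi ε (R + ε))
    have h₂ := integral_add_adjacent_intervals (hi 0 R) (hi R (R + ε))
    linarith
  calc ∫ r in (0 : ℝ)..R, (g (r + ε) - g r) = ∫ s in (0 : ℝ)..ε, (g (s + R) - g s) := h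
    _ ≤ ∫ _ in (0 : ℝ)..ε, N :=
      integral_mono_on hε ((hgR.sub hg).intervalIntegrable _ _) intervalIntegrable_const
        fun s _ => hN _ _ (by linarith)
    _ = ε * N := by simp

theorem phiPlus_sub_phiMinus (φ : ℝ → ℝ) {r : ℝ} (hr : 0 ≤ r) :
    phiPlus φ r - phiMinus φ r = φ r := by
  rw [phiPlus, phiMinus, if_pos hr, if_pos hr]
  ring

/-- For `φ ∈ X` and `ε > 0`: `φ_ε ∈ X`, `φ(r) ≤ φ_ε(r)` for all
`r ≥ 0`, and `∫₀^∞ (φ_ε(r) − φ(r)) dr ≤ 2ε‖φ‖_X`. -/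
theorem phiEps_properties (φ : ℝ → ℝ) (hφ : MemX φ)
    (hint : IntegrableOn (fun r => |deriv φ r|) (Set.Ioi 0))
    (ε : ℝ) (hε : 0 < ε) :
    MemX (phiEps φ ε) ∧
    (∀ r : ℝ, 0 ≤ r → φ r ≤ phiEps φ ε r) ∧
    (∫ r in Set.Ioi (0:ℝ), (phiEps φ ε r - φ r)) ≤ 2 * ε * normX φ := by
  have hint' : IntegrableOn (fun r => |deriv (-φ) r|) (Ioi 0) := by simpa [deriv.neg'] using hint
  have hcp := hφ.continuous_phiPlus hint
  have hcm := hφ.neg.continuous_phiPlus hint'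
  have hmm := hφ.neg.monotone_phiPlus hint'
  have hbp : ∀ a b, a ≤ b → phiPlus φ b - phiPlus φ a ≤ normX φ := fun _ _ =>
    hφ.phiPlus_sub_le hint
  have hbm : ∀ a b, a ≤ b → phiPlus (-φ) b - phiPlus (-φ) a ≤ normX (-φ) := fun _ _ =>
    hφ.neg.phiPlus_sub_le hint'
  rw [← phiMinus_eq_phiPlus_neg] at hcm hmm hbm
  rw [normX_neg] at hbm
  refine ⟨memX_phiEps hφ hint ε, fun r hr => ?_, ?_⟩
  · have h₁ := hφ.monotone_phiPlus hint (show r ≤ r + ε by linarith)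
    have h₂ := hmm (show r - ε ≤ r by linarith)
    rw [← phiPlus_sub_phiMinus φ hr, phiEps]
    linarith
  have hN : 0 ≤ normX φ := by simpa using hbp 0 0 le_rfl
  by_cases hi : IntegrableOn (fun r => phiEps φ ε r - φ r) (Ioi 0)
  · refine le_of_tendsto (intervalIntegral_tendsto_integral_Ioi 0 hi Filter.tendsto_id) ?_
    filter_upwards [Filter.eventually_ge_atTop 0] with R hR
    have hcm' : Continuous fun r => phiMinus φ (r - ε) := by fun_prop
    have h₁ := integral_shift_sub_le hcp hbp hε.le hR
    have h₂ := integral_shift_sub_le hcm' (fun a b hab => hbm _ _ (sub_le_sub_right hab ε))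
      hε.le hR
    calc ∫ r in (0 : ℝ)..R, (phiEps φ ε r - φ r)
        = ∫ r in (0 : ℝ)..R, ((phiPlus φ (r + ε) - phiPlus φ r) +
            (phiMinus φ (r + ε - ε) - phiMinus φ (r - ε))) := by
          refine integral_congr fun r hr => ?_
          rw [uIcc_of_le hR] at hr
          simp only [← phiPlus_sub_phiMinus φ hr.1, phiEps, add_sub_cancel_right]
          ring
      _ ≤ 2 * ε * normX φ := by
          rw [integral_add (Continuous.intervalIntegrable (by fun_prop) _ _)
            (Continuous.intervalIntegrable (by fun_prop) _ _)]
          linarith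
  · rw [integral_undef hi]
    positivity
end
end

section
/- Let ρ and ν be two probability measures on ℝ^d, both supported in the closed ball B_R of radius R centered at the origin, and assume ρ is absolutely continuous with density in L^∞(ℝ^d). Then D(ν,ρ) ≤ C √(W₁(ν,ρ)), where the constant C depends only on the dimension d, on ‖ρ‖_∞ and on R. -/
open MeasureTheory Metric Set

noncomputable section

/-- The discrepancy distance between two measures:
`D(ρ₁,ρ₂) = sup_{x, r>0} |ρ₁(B_r(x)) - ρ₂(B_r(x))|`. -/
def disc {E : Type*} [MeasurableSpace E] [PseudoMetricSpace E]
    (ρ₁ ρ₂ : Measure E) : ℝ :=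
  ⨆ x : E, ⨆ r : ℝ, ⨆ _ : 0 < r,
    |(ρ₁ (closedBall x r)).toReal - (ρ₂ (closedBall x r)).toReal|

/-- The `1`-Wasserstein distance, via duality with bounded `1`-Lipschitz functions. -/
def W1 {E : Type*} [MeasurableSpace E] [PseudoMetricSpace E] (μ ν : Measure E) : ℝ :=
  sSup {a : ℝ | ∃ φ : E → ℝ, LipschitzWith 1 φ ∧ (∃ C : ℝ, ∀ x, |φ x| ≤ C) ∧
    a = (∫ x, φ x ∂μ) - ∫ x, φ x ∂ν}

open scoped Pointwise

/-- The cone spanned by a set `V`, without its apex. -/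
def openCone {E : Type*} [AddCommGroup E] [Module ℝ E] (V : Set E) : Set E :=
  {z | ∃ v ∈ V, ∃ s : ℝ, 0 < s ∧ z = s • v}

section Annulus

variable {E : Type*} [NormedAddCommGroup E] [NormedSpace ℝ E]

lemma openCone_inter_closedBall (V : Set E) {t : ℝ} (ht : 0 < t) :
    openCone V ∩ closedBall 0 t = t • (openCone V ∩ closedBall 0 1) := by
  ext z
  rw [Set.mem_smul_set_iff_inv_smul_mem₀ ht.ne']
  simp only [mem_inter_iff, mem_closedBall_zero_iff, norm_smul, norm_inv, Real.norm_eq_abs,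
    abs_of_pos ht]
  refine and_congr ⟨?_, ?_⟩ ?_
  · rintro ⟨v, hv, s, hs, rfl⟩
    exact ⟨v, hv, t⁻¹ * s, by positivity, by rw [mul_smul]⟩
  · rintro ⟨v, hv, s, hs, h⟩
    refine ⟨v, hv, t * s, by positivity, ?_⟩
    rw [mul_smul, ← h, smul_inv_smul₀ ht.ne']
  · rw [inv_mul_le_iff₀ ht, mul_one]

variable [MeasurableSpace E] [BorelSpace E] [FiniteDimensional ℝ E] [Nontrivial E]
  (μ : Measure E) [μ.IsAddHaarMeasure]

lemma measureReal_openCone_inter_closedBall (V : Set E) {t : ℝ} (ht : 0 ≤ t) :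
    μ.real (openCone V ∩ closedBall 0 t) =
      t ^ Module.finrank ℝ E * μ.real (openCone V ∩ closedBall 0 1) := by
  rcases ht.eq_or_lt with rfl | ht
  · have h : μ (openCone V ∩ closedBall 0 0) = 0 :=
      measure_mono_null inter_subset_right (by simp)
    rw [measureReal_def, h, zero_pow Module.finrank_pos.ne']
    simp
  · rw [openCone_inter_closedBall V ht, measureReal_def, Measure.addHaar_smul,
      ENNReal.toReal_mul, ENNReal.toReal_ofReal (abs_nonneg _), abs_of_pos (by positivity),
      measureReal_def]

lemma measureReal_openCone_inter_annulus (V : Set E) {r t : ℝ} (hr : 0 ≤ r) (hrt : r ≤ t) :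
    μ.real ((openCone V ∩ closedBall 0 t) \ closedBall 0 r) =
      (t ^ Module.finrank ℝ E - r ^ Module.finrank ℝ E) *
        μ.real (openCone V ∩ closedBall 0 1) := by
  have hfin : μ (openCone V ∩ closedBall 0 t) ≠ ⊤ :=
    measure_ne_top_of_subset inter_subset_right measure_closedBall_lt_top.ne
  have h := measureReal_inter_add_sdiff (μ := μ) (s := openCone V ∩ closedBall 0 t)
    (measurableSet_closedBall (x := (0 : E)) (ε := r)) hfin
  rw [inter_assoc, inter_eq_right.2 (closedBall_subset_closedBall hrt),
    measureReal_openCone_inter_closedBall μ V hr,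
    measureReal_openCone_inter_closedBall μ V (hr.trans hrt)] at h
  linarith

lemma pow_add_sub_pow_mul_le (n : ℕ) {r ε R : ℝ} (hr : 0 ≤ r) (hε : 0 ≤ ε) (hεR : ε ≤ R)
    (hR : 0 < R) : ((r + ε) ^ n - r ^ n) * R ≤ ε * ((r + R) ^ n - r ^ n) := by
  have h := (convexOn_pow n).2 (mem_Ici.2 hr) (mem_Ici.2 (by linarith : (0 : ℝ) ≤ r + R))
    (sub_nonneg.2 ((div_le_one hR).2 hεR)) (div_nonneg hε hR.le) (by ring)
  simp only [smul_eq_mul] at h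
  rw [show (1 - ε / R) * r + ε / R * (r + R) = r + ε by field_simp; ring] at h
  have h' := mul_le_mul_of_nonneg_right h hR.le
  have : ((1 - ε / R) * r ^ n + ε / R * (r + R) ^ n) * R =
      (R - ε) * r ^ n + ε * (r + R) ^ n := by field_simp
  linarith

/-- The part of a thin annulus lying in a fixed ball has volume at most linear in the thickness
of the annulus, uniformly in its center and radius. -/
lemma measureReal_closedBall_inter_annulus_mul_le (x : E) {r ε R : ℝ} (hr : 0 ≤ r) (hε : 0 ≤ ε)
    (hεR : ε ≤ R) (hR : 0 < R) :
    μ.real (closedBall 0 R ∩ (closedBall x (r + ε) \ closedBall x r)) * R ≤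
      ε * μ.real (closedBall 0 (2 * R)) := by
  set V : Set E := (fun v ↦ x + v) ⁻¹' (closedBall 0 R ∩ (closedBall x (r + ε) \ closedBall x r))
    with hVdef
  have hV : μ.real V = μ.real (closedBall 0 R ∩ (closedBall x (r + ε) \ closedBall x r)) := by
    rw [measureReal_def, hVdef, measure_preimage_add, measureReal_def]
  have mem_V {v : E} : v ∈ V ↔ ‖x + v‖ ≤ R ∧ ‖v‖ ≤ r + ε ∧ r < ‖v‖ := by
    simp [hVdef, dist_eq_norm, add_comm v x]
  have hle : μ.real V ≤ μ.real ((openCone V ∩ closedBall 0 (r + ε)) \ closedBall 0 r) := by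
    refine measureReal_mono (fun v hv ↦ ?_) (measure_ne_top_of_subset
      (sdiff_subset.trans inter_subset_right) measure_closedBall_lt_top.ne)
    obtain ⟨-, h2, h3⟩ := mem_V.1 hv
    exact ⟨⟨⟨v, hv, 1, one_pos, (one_smul _ _).symm⟩, by simpa using h2⟩, by simpa using h3⟩
  have hsub : (openCone V ∩ closedBall 0 (r + R)) \ closedBall 0 r ⊆
      (fun v ↦ x + v) ⁻¹' closedBall 0 (2 * R) := by
    rintro _ ⟨⟨⟨v, hv, s, hs, rfl⟩, h1⟩, h2⟩
    obtain ⟨h3, h4, h5⟩ := mem_V.1 hv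
    simp only [mem_closedBall_zero_iff, norm_smul, Real.norm_eq_abs, abs_of_pos hs, not_le,
      mem_preimage] at h1 h2 ⊢
    have h6 : ‖(s - 1) • v‖ ≤ R := by
      rw [norm_smul, Real.norm_eq_abs, ← abs_of_nonneg (norm_nonneg v), ← abs_mul, abs_le]
      constructor <;> nlinarith
    calc ‖x + s • v‖ = ‖(x + v) + (s - 1) • v‖ := by rw [sub_smul, one_smul]; congr 1; abel
      _ ≤ ‖x + v‖ + ‖(s - 1) • v‖ := norm_add_le _ _
      _ ≤ 2 * R := by linarith
  have hle' : μ.real ((openCone V ∩ closedBall 0 (r + R)) \ closedBall 0 r) ≤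
      μ.real (closedBall 0 (2 * R)) := by
    have hpre : μ ((fun v ↦ x + v) ⁻¹' closedBall 0 (2 * R)) = μ (closedBall 0 (2 * R)) :=
      measure_preimage_add _ _ _
    rw [measureReal_def, measureReal_def, ← hpre]
    exact ENNReal.toReal_mono (hpre ▸ measure_closedBall_lt_top.ne) (measure_mono hsub)
  rw [measureReal_openCone_inter_annulus μ V hr (by linarith)] at hle hle'
  rw [← hV]
  have hm : 0 ≤ μ.real (openCone V ∩ closedBall 0 1) := measureReal_nonneg
  calc μ.real V * R
      ≤ ((r + ε) ^ Module.finrank ℝ E - r ^ Module.finrank ℝ E) *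
          μ.real (openCone V ∩ closedBall 0 1) * R := by gcongr
    _ = ((r + ε) ^ Module.finrank ℝ E - r ^ Module.finrank ℝ E) * R *
          μ.real (openCone V ∩ closedBall 0 1) := by ring
    _ ≤ ε * ((r + R) ^ Module.finrank ℝ E - r ^ Module.finrank ℝ E) *
          μ.real (openCone V ∩ closedBall 0 1) :=
        mul_le_mul_of_nonneg_right (pow_add_sub_pow_mul_le _ hr hε hεR hR) hm
    _ ≤ ε * μ.real (closedBall 0 (2 * R)) := by
        rw [mul_assoc]; gcongr

/-- A probability measure concentrated on a ball and dominated by a multiple of Haar measure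
has balls whose mass is Lipschitz in the radius. -/
lemma measureReal_closedBall_add_le {R B : ℝ} (hR : 0 < R) (hB : 0 ≤ B) (ρ : Measure E)
    [IsProbabilityMeasure ρ] (hρ : ∀ s, ρ s ≤ ENNReal.ofReal B * μ s)
    (hρR : ρ (closedBall 0 R)ᶜ = 0) (x : E) (r : ℝ) {ε : ℝ} (hε : 0 ≤ ε) :
    ρ.real (closedBall x (r + ε)) ≤
      ρ.real (closedBall x r) + (B * μ.real (closedBall 0 (2 * R)) / R + 1 / R) * ε := by
  have hK : 0 ≤ B * μ.real (closedBall 0 (2 * R)) / R := by positivity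
  rcases le_total R ε with hRε | hεR
  · have h1 : 1 ≤ 1 / R * ε := by rw [one_div, ← div_eq_inv_mul]; exact (one_le_div hR).2 hRε
    have h2 : ρ.real (closedBall x (r + ε)) ≤ 1 := measureReal_le_one
    have h3 : 0 ≤ ρ.real (closedBall x r) := measureReal_nonneg
    nlinarith [mul_nonneg hK hε]
  have hnull : ρ.real (closedBall x (max r 0) \ closedBall x r) = 0 := by
    rcases le_total r 0 with hr | hr
    · have : ρ {x} = 0 := by simpa using hρ {x}
      rw [max_eq_right hr, closedBall_zero, measureReal_def,
        measure_mono_null sdiff_subset this, ENNReal.toReal_zero]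
    · simp [max_eq_left hr]
  have hcompl : ρ.real (closedBall 0 R)ᶜ = 0 := by simp [measureReal_def, hρR]
  set A := closedBall 0 R ∩ (closedBall x (max r 0 + ε) \ closedBall x (max r 0)) with hA
  have hAμ : ρ.real A ≤ B * μ.real A := by
    rw [measureReal_def, measureReal_def, ← ENNReal.toReal_ofReal hB, ← ENNReal.toReal_mul]
    exact ENNReal.toReal_mono (ENNReal.mul_ne_top ENNReal.ofReal_ne_top
      (measure_ne_top_of_subset inter_subset_left measure_closedBall_lt_top.ne)) (hρ A)
  have hAε : μ.real A ≤ ε * μ.real (closedBall 0 (2 * R)) / R := by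
    rw [le_div_iff₀ hR]
    exact measureReal_closedBall_inter_annulus_mul_le μ x (le_max_right _ _) hε hεR hR
  have hcover : closedBall x (r + ε) ⊆
      closedBall x r ∪ (closedBall x (max r 0) \ closedBall x r) ∪ (closedBall 0 R)ᶜ ∪ A := by
    intro y hy
    have hy' : y ∈ closedBall x (max r 0 + ε) :=
      closedBall_subset_closedBall (by gcongr; exact le_max_left _ _) hy
    simp only [hA, mem_union, mem_inter_iff, mem_sdiff, mem_compl_iff]
    tauto
  calc ρ.real (closedBall x (r + ε))
      ≤ ρ.real (closedBall x r) + ρ.real (closedBall x (max r 0) \ closedBall x r) +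
          ρ.real (closedBall 0 R)ᶜ + ρ.real A := by
        refine (measureReal_mono hcover).trans ((measureReal_union_le _ _).trans ?_)
        gcongr
        refine (measureReal_union_le _ _).trans ?_
        gcongr
        exact measureReal_union_le _ _
    _ ≤ ρ.real (closedBall x r) + B * (ε * μ.real (closedBall 0 (2 * R)) / R) := by
        rw [hnull, hcompl, add_zero, add_zero]
        gcongr
        exact hAμ.trans (by gcongr)
    _ ≤ _ := by
        have : 0 ≤ 1 / R * ε := by positivity
        rw [add_mul, ← add_assoc]
        refine (le_add_of_nonneg_right this).trans' (le_of_eq ?_)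
        ring

end Annulus

section Wasserstein

lemma W1_comm {E : Type*} [MeasurableSpace E] [PseudoMetricSpace E] (μ ν : Measure E) :
    W1 μ ν = W1 ν μ := by
  have key (μ ν : Measure E) (a : ℝ) :
      (∃ φ : E → ℝ, LipschitzWith 1 φ ∧ (∃ C : ℝ, ∀ x, |φ x| ≤ C) ∧
        a = (∫ x, φ x ∂μ) - ∫ x, φ x ∂ν) →
      ∃ φ : E → ℝ, LipschitzWith 1 φ ∧ (∃ C : ℝ, ∀ x, |φ x| ≤ C) ∧
        a = (∫ x, φ x ∂ν) - ∫ x, φ x ∂μ := by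
    rintro ⟨φ, hφ, ⟨C, hC⟩, rfl⟩
    refine ⟨fun x ↦ -φ x, hφ.neg, ⟨C, by simpa using hC⟩, ?_⟩
    rw [integral_neg, integral_neg]
    ring
  exact congrArg sSup (Set.ext fun a ↦ ⟨key μ ν a, key ν μ a⟩)

lemma W1_nonneg {E : Type*} [MeasurableSpace E] [PseudoMetricSpace E] (μ ν : Measure E) :
    0 ≤ W1 μ ν := by
  by_cases h : BddAbove {a : ℝ | ∃ φ : E → ℝ, LipschitzWith 1 φ ∧ (∃ C : ℝ, ∀ x, |φ x| ≤ C) ∧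
    a = (∫ x, φ x ∂μ) - ∫ x, φ x ∂ν}
  · exact le_csSup h ⟨fun _ ↦ 0, LipschitzWith.const' 0, ⟨0, by simp⟩, by simp⟩
  · exact (Real.sSup_of_not_bddAbove h).ge

variable {E : Type*} [MeasurableSpace E] [PseudoMetricSpace E] [OpensMeasurableSpace E]

lemma LipschitzWith.integrable_of_bounded {φ : E → ℝ} (hφ : LipschitzWith 1 φ)
    {C : ℝ} (hC : ∀ x, |φ x| ≤ C) (μ : Measure E) [IsFiniteMeasure μ] : Integrable φ μ :=
  .of_bound hφ.continuous.measurable.aestronglyMeasurable C (.of_forall hC)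

lemma integral_sub_integral_le_W1 {μ ν : Measure E} [IsProbabilityMeasure μ]
    [IsProbabilityMeasure ν] {o : E} {R : ℝ} (hμ : μ (closedBall o R)ᶜ = 0)
    (hν : ν (closedBall o R)ᶜ = 0) {φ : E → ℝ} (hφ : LipschitzWith 1 φ)
    {C : ℝ} (hC : ∀ x, |φ x| ≤ C) :
    (∫ x, φ x ∂μ) - ∫ x, φ x ∂ν ≤ W1 μ ν := by
  refine le_csSup ⟨2 * R, ?_⟩ ⟨φ, hφ, ⟨C, hC⟩, rfl⟩
  rintro _ ⟨ψ, hψ, ⟨C', hC'⟩, rfl⟩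
  have hdist {y : E} (hy : y ∈ closedBall o R) : |ψ y - ψ o| ≤ R := by
    have := hψ.dist_le_mul y o
    rw [NNReal.coe_one, one_mul, Real.dist_eq] at this
    exact this.trans hy
  have h1 : ∫ x, ψ x ∂μ ≤ ψ o + R := by
    calc ∫ x, ψ x ∂μ ≤ ∫ _, (ψ o + R) ∂μ := by
          refine integral_mono_ae (hψ.integrable_of_bounded hC' μ) (integrable_const _) ?_
          filter_upwards [mem_ae_iff.2 hμ] with y hy
          linarith [(abs_le.1 (hdist hy)).2]
      _ = ψ o + R := by simp
  have h2 : ψ o - R ≤ ∫ x, ψ x ∂ν := by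
    calc ψ o - R = ∫ _, (ψ o - R) ∂ν := by simp
      _ ≤ ∫ x, ψ x ∂ν := by
          refine integral_mono_ae (integrable_const _) (hψ.integrable_of_bounded hC' ν) ?_
          filter_upwards [mem_ae_iff.2 hν] with y hy
          linarith [(abs_le.1 (hdist hy)).1]
  linarith

lemma measureReal_closedBall_le_add_W1_div {μ ν : Measure E} [IsProbabilityMeasure μ]
    [IsProbabilityMeasure ν] {o : E} {R : ℝ} (hμ : μ (closedBall o R)ᶜ = 0)
    (hν : ν (closedBall o R)ᶜ = 0) (x : E) (r : ℝ) {ε : ℝ} (hε : 0 < ε) :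
    μ.real (closedBall x r) ≤ ν.real (closedBall x (r + ε)) + W1 μ ν / ε := by
  set φ : E → ℝ := fun y ↦ max (min (r + ε - dist y x) ε) 0 with hφdef
  have hφ : LipschitzWith 1 φ := by
    have h : LipschitzWith 1 fun y ↦ r + ε - dist y x := by
      simpa using (LipschitzWith.const (r + ε)).sub (LipschitzWith.dist_left x)
    exact (h.min_const ε).max_const 0
  have hC (y : E) : |φ y| ≤ ε := by
    rw [abs_of_nonneg (le_max_right _ _)]
    exact max_le (min_le_right _ _) hε.le
  have h1 : μ.real (closedBall x r) * ε ≤ ∫ y, φ y ∂μ := by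
    rw [← smul_eq_mul, ← integral_indicator_const ε measurableSet_closedBall]
    refine integral_mono ((integrable_const ε).indicator measurableSet_closedBall)
      (hφ.integrable_of_bounded hC μ) (indicator_le' (fun y hy ↦ ?_) fun y _ ↦ le_max_right _ _)
    refine le_max_of_le_left (le_min ?_ le_rfl)
    linarith [mem_closedBall.1 hy]
  have h2 : ∫ y, φ y ∂ν ≤ ν.real (closedBall x (r + ε)) * ε := by
    rw [← smul_eq_mul, ← integral_indicator_const ε measurableSet_closedBall]
    refine integral_mono (hφ.integrable_of_bounded hC ν)
      ((integrable_const ε).indicator measurableSet_closedBall)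
      (le_indicator (fun y _ ↦ (le_abs_self _).trans (hC y)) fun y hy ↦ ?_)
    refine max_le (min_le_of_left_le ?_) le_rfl
    linarith [not_le.1 (mt mem_closedBall.2 hy)]
  have h3 := integral_sub_integral_le_W1 hμ hν hφ hC
  rw [← sub_le_iff_le_add', le_div_iff₀ hε]
  linarith

end Wasserstein

lemma le_mul_sqrt_of_forall_le {a K w : ℝ} (hK : 0 ≤ K) (hw : 0 ≤ w)
    (h : ∀ ε > 0, a ≤ K * ε + w / ε) : a ≤ (K + 1) * √w := by
  rcases hw.eq_or_lt with rfl | hw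
  · simp only [zero_div, add_zero, Real.sqrt_zero, mul_zero] at h ⊢
    refine le_of_forall_pos_le_add fun δ hδ ↦ (h (δ / (K + 1)) (by positivity)).trans ?_
    rw [zero_add, mul_div_assoc', div_le_iff₀ (by positivity)]
    nlinarith
  · refine (h _ (Real.sqrt_pos.2 hw)).trans (le_of_eq ?_)
    rw [Real.div_sqrt]
    ring

/-- For probability measures `ρ`, `ν` on `ℝ^d` supported in the ball
`B_R`, with `ρ` absolutely continuous with density bounded by `B`, one has
`D(ν,ρ) ≤ C √(W₁(ν,ρ))` with `C` depending only on `d`, the `L^∞` bound `B` and `R`. -/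
theorem disc_le_sqrt_W1 (d : ℕ) (R B : ℝ) (hR : 0 < R) (hB : 0 < B) :
    ∃ C : ℝ, 0 < C ∧
      ∀ (ρ ν : Measure (EuclideanSpace ℝ (Fin d)))
        (f : EuclideanSpace ℝ (Fin d) → ℝ),
        IsProbabilityMeasure ρ → IsProbabilityMeasure ν →
        Measurable f → (∀ x, 0 ≤ f x) → (∀ᵐ x ∂volume, f x ≤ B) →
        ρ = volume.withDensity (fun x => ENNReal.ofReal (f x)) →
        ρ (closedBall 0 R)ᶜ = 0 → ν (closedBall 0 R)ᶜ = 0 →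
        disc ν ρ ≤ C * Real.sqrt (W1 ν ρ) := by
  set K : ℝ := B * volume.real (closedBall (0 : EuclideanSpace ℝ (Fin d)) (2 * R)) / R + 1 / R
    with hKdef
  have hK : 0 ≤ K := by positivity
  refine ⟨K + 1, by positivity, fun ρ ν f hρ1 hν1 _ _ hfB hρf hρR hνR ↦ ?_⟩
  have hC : 0 ≤ (K + 1) * √(W1 ν ρ) := by positivity
  refine Real.iSup_le (fun x ↦ Real.iSup_le (fun r ↦ Real.iSup_le (fun hr ↦ ?_) hC) hC) hC
  rcases Nat.eq_zero_or_pos d with rfl | hd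
  · have : closedBall x r = univ :=
      eq_univ_of_forall fun y ↦ by simpa [Subsingleton.elim y x] using hr.le
    simpa [this] using hC
  have : Nonempty (Fin d) := ⟨⟨0, hd⟩⟩
  have hdom (s) : ρ s ≤ ENNReal.ofReal B * volume s := by
    have : ρ ≤ ENNReal.ofReal B • volume := by
      rw [hρf, ← withDensity_const]
      exact withDensity_mono (hfB.mono fun y hy ↦ ENNReal.ofReal_le_ofReal hy)
    exact this s
  refine le_mul_sqrt_of_forall_le hK (W1_nonneg ν ρ) fun ε hε ↦ abs_sub_le_iff.2 ⟨?_, ?_⟩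
  · have h1 := measureReal_closedBall_le_add_W1_div hνR hρR x r hε
    have h2 := measureReal_closedBall_add_le volume hR hB.le ρ hdom hρR x r hε.le
    simp only [measureReal_def] at h1 h2 hKdef
    rw [← hKdef] at h2
    linarith
  · have h1 := measureReal_closedBall_le_add_W1_div hρR hνR x (r - ε) hε
    have h2 := measureReal_closedBall_add_le volume hR hB.le ρ hdom hρR x (r - ε) hε.le
    rw [sub_add_cancel] at h1 h2
    rw [W1_comm] at h1
    simp only [measureReal_def] at h1 h2 hKdef
    rw [← hKdef] at h2
    linarith
end
end

section
/- Let μ^N = (1/N) Σ_{i=1}^N δ_{x_i} and ν^N = (1/N) Σ_{i=1}^N δ_{y_i} be two empirical measures on ℝ^d and let δ > 0 be such that |x_i − y_i| ≤ δ for all i = 1,…,N. Then for any probability measure ρ on ℝ^d that is absolutely continuous with density in L^∞(ℝ^d) and supported in the closed ball B_R, one has D(μ^N,ν^N) ≤ c R^{d−1} δ ‖ρ‖_∞ + c D(μ^N,ρ), where c depends only on the dimension d. -/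
open MeasureTheory Metric Set
open scoped ENNReal

noncomputable section

/-- The empirical measure `(1/N) Σ_{i=1}^N δ_{x_i}`. -/
def empMeasure {E : Type*} [MeasurableSpace E] {N : ℕ} (x : Fin N → E) : Measure E :=
  ((N : ℝ≥0∞))⁻¹ • ∑ i : Fin N, Measure.dirac (x i)

theorem volume_le_of_slice {n : ℕ} (i : Fin (n + 1)) {S : Set (Fin (n + 1) → ℝ)}
    (hS : MeasurableSet S) {R L : ℝ} (hR : 0 ≤ R) (hSR : ∀ z ∈ S, ∀ j, |z j| ≤ R)
    (hL : ∀ z ∈ S, ∀ w ∈ S, (∀ j, z (i.succAbove j) = w (i.succAbove j)) →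
      |z i - w i| ≤ L) :
    volume S ≤ ENNReal.ofReal L * ENNReal.ofReal ((2 * R) ^ n) := by
  have hmp := (volume_preserving_piFinSuccAbove (fun _ : Fin (n + 1) => ℝ) i).symm
  rw [← hmp.measure_preimage hS.nullMeasurableSet]
  have hS' := hmp.measurable hS
  change Measure.prod _ _ _ ≤ _
  rw [Measure.prod_apply_symm hS']
  calc _ ≤ ∫⁻ v, (closedBall (0 : Fin n → ℝ) R).indicator
        (fun _ => ENNReal.ofReal L) v ∂volume := by
        refine lintegral_mono fun v => ?_
        by_cases hv : v ∈ closedBall (0 : Fin n → ℝ) R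
        · rw [indicator_of_mem hv]
          refine (Real.volume_le_diam _).trans (Metric.ediam_le fun a ha b hb => ?_)
          rw [edist_dist, Real.dist_eq]
          refine ENNReal.ofReal_le_ofReal ?_
          simpa using hL _ ha _ hb (fun j => by simp)
        · rw [indicator_of_notMem hv, nonpos_iff_eq_zero]
          convert measure_empty (μ := volume)
          refine eq_empty_of_forall_notMem fun a ha => hv ?_
          rw [mem_closedBall_zero_iff, pi_norm_le_iff_of_nonneg hR]
          intro j
          simpa using hSR _ ha (i.succAbove j)
    _ = _ := by
        rw [lintegral_indicator_const isClosed_closedBall.measurableSet,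
          Real.volume_pi_closedBall _ hR, Fintype.card_fin]

theorem volume_annulus_cone_le {n : ℕ} (i : Fin (n + 1)) {σ : ℝ} (hσ : |σ| = 1)
    (x : EuclideanSpace ℝ (Fin (n + 1))) {R s δ K : ℝ} (hR : 0 ≤ R) (hK : 0 < K) :
    volume {z : EuclideanSpace ℝ (Fin (n + 1)) | ‖z‖ ≤ R ∧ s ≤ ‖z - x‖ ∧ ‖z - x‖ ≤ s + δ ∧
      ‖z - x‖ ≤ K * (σ * (z i - x i))} ≤
      ENNReal.ofReal (K * δ) * ENNReal.ofReal ((2 * R) ^ n) := by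
  have hmeas : MeasurableSet {z : EuclideanSpace ℝ (Fin (n + 1)) | ‖z‖ ≤ R ∧ s ≤ ‖z - x‖ ∧
      ‖z - x‖ ≤ s + δ ∧ ‖z - x‖ ≤ K * (σ * (z i - x i))} := by
    apply IsClosed.measurableSet
    refine .and (isClosed_le ?_ ?_) (.and (isClosed_le ?_ ?_) (.and (isClosed_le ?_ ?_)
      (isClosed_le ?_ ?_))) <;> fun_prop
  have hmp := PiLp.volume_preserving_toLp (Fin (n + 1))
  rw [← hmp.measure_preimage hmeas.nullMeasurableSet]
  refine volume_le_of_slice i (hmp.measurable hmeas) hR (fun z hz j => ?_) ?_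
  · exact (PiLp.norm_apply_le (WithLp.toLp 2 z) j).trans hz.1
  rintro z ⟨-, hz1, hz2, hz3⟩ w ⟨-, hw1, hw2, hw3⟩ h
  have hzs := EuclideanSpace.real_norm_sq_eq (WithLp.toLp 2 z - x)
  have hws := EuclideanSpace.real_norm_sq_eq (WithLp.toLp 2 w - x)
  rw [Fin.sum_univ_succAbove _ i] at hzs hws
  simp only [PiLp.sub_apply, h] at hzs hws hz3 hw3
  have hz0 := norm_nonneg (WithLp.toLp 2 z - x)
  have hw0 := norm_nonneg (WithLp.toLp 2 w - x)
  generalize ‖WithLp.toLp 2 z - x‖ = p at *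
  generalize ‖WithLp.toLp 2 w - x‖ = q at *
  have key : (p - q) * (p + q) = (z i - w i) * ((z i - x i) + (w i - x i)) := by
    linear_combination hzs - hws
  have hpq : |p - q| ≤ δ := by rw [abs_le]; constructor <;> linarith
  have ha : 0 ≤ σ * (z i - x i) := nonneg_of_mul_nonneg_right (hz0.trans hz3) hK
  have hb : 0 ≤ σ * (w i - x i) := nonneg_of_mul_nonneg_right (hw0.trans hw3) hK
  have habs : |(z i - x i) + (w i - x i)| = σ * (z i - x i) + σ * (w i - x i) := by
    rw [← one_mul |_|, ← hσ, ← abs_mul, mul_add, abs_of_nonneg (add_nonneg ha hb)]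
  have hzw : |z i - w i| = |σ * (z i - x i) - σ * (w i - x i)| := by
    rw [← one_mul |z i - w i|, ← hσ, ← abs_mul]; ring_nf
  have hmul : |z i - w i| * |(z i - x i) + (w i - x i)| = |p - q| * (p + q) := by
    rw [← abs_mul, ← key, abs_mul, abs_of_nonneg (add_nonneg hz0 hw0)]
  rw [habs] at hmul
  have hδ : 0 ≤ δ := (abs_nonneg _).trans hpq
  rcases (add_nonneg ha hb).eq_or_lt with h0 | h0
  · have ha0 : σ * (z i - x i) = 0 := by linarith
    have hb0 : σ * (w i - x i) = 0 := by linarith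
    rw [hzw, ha0, hb0, sub_zero, abs_zero]
    positivity
  · refine le_of_mul_le_mul_right ?_ h0
    rw [hmul]
    calc |p - q| * (p + q) ≤ δ * (K * (σ * (z i - x i)) + K * (σ * (w i - x i))) := by
          gcongr
      _ = _ := by ring

theorem exists_norm_le_card_mul_abs {n : ℕ} (w : EuclideanSpace ℝ (Fin (n + 1))) :
    ∃ i, ‖w‖ ≤ ((n : ℝ) + 1) * |w i| := by
  obtain ⟨i, -, hi⟩ := Finset.exists_le_of_sum_le (s := Finset.univ)
    (f := fun _ : Fin (n + 1) => ‖w‖ ^ 2) (g := fun i => ((n : ℝ) + 1) * w i ^ 2)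
    Finset.univ_nonempty (by
      rw [← Finset.mul_sum, ← EuclideanSpace.real_norm_sq_eq]; simp)
  refine ⟨i, le_of_sq_le_sq ?_ (by positivity)⟩
  rw [mul_pow, sq_abs]
  have h1 : (n : ℝ) + 1 ≤ ((n : ℝ) + 1) ^ 2 := by nlinarith [(n.cast_nonneg : (0 : ℝ) ≤ n)]
  exact hi.trans (by gcongr)

/-- The part of a spherical shell of width `δ` inside a ball of radius `R` has volume
`O(R ^ (d - 1) * δ)`, uniformly in the center and the radius of the shell. -/
theorem volume_closedBall_inter_annulus_le {n : ℕ} (x : EuclideanSpace ℝ (Fin (n + 1)))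
    {R s δ : ℝ} (hR : 0 ≤ R) (hδ : 0 ≤ δ) :
    volume (closedBall 0 R ∩ {z : EuclideanSpace ℝ (Fin (n + 1)) |
      s ≤ dist z x ∧ dist z x ≤ s + δ}) ≤
      ENNReal.ofReal (2 * ((n : ℝ) + 1) ^ 2 * 2 ^ n * R ^ n * δ) := by
  set S : Fin (n + 1) → ℝ → Set (EuclideanSpace ℝ (Fin (n + 1))) := fun i σ =>
    {z | ‖z‖ ≤ R ∧ s ≤ ‖z - x‖ ∧ ‖z - x‖ ≤ s + δ ∧
      ‖z - x‖ ≤ ((n : ℝ) + 1) * (σ * (z i - x i))}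
  have hS_le (i : Fin (n + 1)) {σ : ℝ} (hσ : |σ| = 1) : volume (S i σ) ≤
      ENNReal.ofReal ((((n : ℝ) + 1) * δ) * (2 * R) ^ n) := by
    rw [ENNReal.ofReal_mul (by positivity)]
    exact volume_annulus_cone_le i hσ x hR (by positivity)
  calc _ ≤ volume (⋃ i, (S i 1 ∪ S i (-1))) := by
        refine measure_mono fun z hz => ?_
        obtain ⟨hzR, hz1, hz2⟩ := hz
        rw [mem_closedBall_zero_iff] at hzR
        rw [dist_eq_norm] at hz1 hz2
        obtain ⟨i, hi⟩ := exists_norm_le_card_mul_abs (z - x)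
        rw [PiLp.sub_apply] at hi
        refine mem_iUnion.2 ⟨i, ?_⟩
        rcases abs_choice (z i - x i) with h | h
        · exact Or.inl ⟨hzR, hz1, hz2, by rwa [one_mul, ← h]⟩
        · exact Or.inr ⟨hzR, hz1, hz2, by rwa [neg_one_mul, ← h]⟩
    _ ≤ ∑ _i : Fin (n + 1), (ENNReal.ofReal ((((n : ℝ) + 1) * δ) * (2 * R) ^ n) +
          ENNReal.ofReal ((((n : ℝ) + 1) * δ) * (2 * R) ^ n)) := by
        refine (measure_iUnion_fintype_le _ _).trans (Finset.sum_le_sum fun i _ => ?_)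
        exact (measure_union_le _ _).trans (add_le_add (hS_le i (by simp)) (hS_le i (by simp)))
    _ = _ := by
        rw [← ENNReal.ofReal_add (by positivity) (by positivity),
          ← ENNReal.ofReal_sum_of_nonneg (fun _ _ => by positivity)]
        congr 1
        simp only [Finset.sum_const, Finset.card_univ, Fintype.card_fin, nsmul_eq_mul]
        push_cast
        ring

theorem disc_term_le_one {E : Type*} [MeasurableSpace E] (ρ₁ ρ₂ : Measure E)
    [IsProbabilityMeasure ρ₁] [IsProbabilityMeasure ρ₂] (s : Set E) :
    |(ρ₁ s).toReal - (ρ₂ s).toReal| ≤ 1 := by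
  have h1 := measureReal_le_one (μ := ρ₁) (s := s)
  have h2 := measureReal_le_one (μ := ρ₂) (s := s)
  have h3 := measureReal_nonneg (μ := ρ₁) (s := s)
  have h4 := measureReal_nonneg (μ := ρ₂) (s := s)
  rw [Measure.real] at *
  rw [abs_le]
  constructor <;> linarith

theorem abs_sub_le_disc {E : Type*} [MeasurableSpace E] [PseudoMetricSpace E]
    (ρ₁ ρ₂ : Measure E) [IsProbabilityMeasure ρ₁] [IsProbabilityMeasure ρ₂] (x : E) {r : ℝ}
    (hr : 0 < r) :
    |(ρ₁ (closedBall x r)).toReal - (ρ₂ (closedBall x r)).toReal| ≤ disc ρ₁ ρ₂ := by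
  have h1 (x : E) (r : ℝ) : ⨆ _ : 0 < r,
      |(ρ₁ (closedBall x r)).toReal - (ρ₂ (closedBall x r)).toReal| ≤ 1 :=
    Real.iSup_le (fun _ => disc_term_le_one ρ₁ ρ₂ _) zero_le_one
  refine le_ciSup_of_le ⟨1, ?_⟩ x (le_ciSup_of_le ⟨1, ?_⟩ r (le_ciSup_of_le ⟨1, ?_⟩ hr le_rfl))
  · rintro _ ⟨x, rfl⟩
    exact Real.iSup_le (h1 x) zero_le_one
  · rintro _ ⟨r, rfl⟩
    exact h1 x r
  · rintro _ ⟨_, rfl⟩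
    exact disc_term_le_one ρ₁ ρ₂ _

theorem disc_le {E : Type*} [MeasurableSpace E] [PseudoMetricSpace E]
    {ρ₁ ρ₂ : Measure E} {C : ℝ} (hC : 0 ≤ C) (h : ∀ x : E, ∀ r : ℝ, 0 < r →
      |(ρ₁ (closedBall x r)).toReal - (ρ₂ (closedBall x r)).toReal| ≤ C) :
    disc ρ₁ ρ₂ ≤ C :=
  Real.iSup_le (fun x => Real.iSup_le (fun r => Real.iSup_le (h x r) hC) hC) hC

theorem disc_nonneg {E : Type*} [MeasurableSpace E] [PseudoMetricSpace E]
    (ρ₁ ρ₂ : Measure E) : 0 ≤ disc ρ₁ ρ₂ :=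
  Real.iSup_nonneg fun _ => Real.iSup_nonneg fun _ => Real.iSup_nonneg fun _ => abs_nonneg _

theorem isProbabilityMeasure_empMeasure {E : Type*} [MeasurableSpace E] {N : ℕ} (hN : 0 < N)
    (x : Fin N → E) : IsProbabilityMeasure (empMeasure x) := by
  constructor
  simp only [empMeasure, Measure.smul_apply, Measure.finsetSum_apply, measure_univ,
    Finset.sum_const, Finset.card_univ, Fintype.card_fin, nsmul_eq_mul, mul_one, smul_eq_mul]
  exact ENNReal.inv_mul_cancel (by exact_mod_cast hN.ne') (ENNReal.natCast_ne_top N)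

theorem empMeasure_mono {E : Type*} [MeasurableSpace E] {N : ℕ} {x y : Fin N → E} {s t : Set E}
    (hs : MeasurableSet s) (ht : MeasurableSet t) (h : ∀ i, x i ∈ s → y i ∈ t) :
    empMeasure x s ≤ empMeasure y t := by
  simp only [empMeasure, Measure.smul_apply, Measure.finsetSum_apply, smul_eq_mul,
    Measure.dirac_apply' _ hs, Measure.dirac_apply' _ ht]
  gcongr with i
  by_cases hi : x i ∈ s
  · simp [hi, h i hi]
  · simp [hi]

theorem withDensity_inter_annulus_le {n : ℕ} {R B s δ : ℝ} (hR : 0 ≤ R) (hB : 0 ≤ B)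
    (hδ : 0 ≤ δ) {f : EuclideanSpace ℝ (Fin (n + 1)) → ℝ} (hfB : ∀ᵐ z ∂volume, f z ≤ B)
    {ρ : Measure (EuclideanSpace ℝ (Fin (n + 1)))}
    (hρ : ρ = volume.withDensity (fun z => ENNReal.ofReal (f z)))
    (hρR : ρ (closedBall 0 R)ᶜ = 0) (x : EuclideanSpace ℝ (Fin (n + 1))) :
    (ρ {z | s ≤ dist z x ∧ dist z x ≤ s + δ}).toReal ≤
      2 * ((n : ℝ) + 1) ^ 2 * 2 ^ n * R ^ n * δ * B := by
  refine ENNReal.toReal_le_of_le_ofReal (by positivity) ?_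
  set A : Set (EuclideanSpace ℝ (Fin (n + 1))) := {z | s ≤ dist z x ∧ dist z x ≤ s + δ}
  have hle : ρ ≤ ENNReal.ofReal B • volume := by
    rw [hρ, ← withDensity_const]
    exact withDensity_mono (hfB.mono fun z hz => ENNReal.ofReal_le_ofReal hz)
  calc ρ A ≤ ρ (closedBall 0 R ∩ A) + ρ (closedBall 0 R)ᶜ := by
        refine (measure_mono fun z hz => ?_).trans (measure_union_le _ _)
        by_cases h : z ∈ closedBall 0 R
        · exact Or.inl ⟨h, hz⟩
        · exact Or.inr h
    _ ≤ ENNReal.ofReal B * volume (closedBall 0 R ∩ A) := by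
        rw [hρR, add_zero]
        exact hle _
    _ ≤ ENNReal.ofReal B * ENNReal.ofReal (2 * ((n : ℝ) + 1) ^ 2 * 2 ^ n * R ^ n * δ) := by
        gcongr
        exact volume_closedBall_inter_annulus_le x hR hδ
    _ = _ := by rw [← ENNReal.ofReal_mul hB, mul_comm]

theorem measureReal_closedBall_add_le_s6 {E : Type*} [MeasurableSpace E] [PseudoMetricSpace E]
    (ρ : Measure E) [IsFiniteMeasure ρ] (x : E) (s δ : ℝ) :
    (ρ (closedBall x (s + δ))).toReal ≤
      (ρ (closedBall x s)).toReal + (ρ {z | s ≤ dist z x ∧ dist z x ≤ s + δ}).toReal := by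
  refine (measureReal_mono fun z hz => ?_).trans
    (measureReal_union_le (μ := ρ) (closedBall x s) {z | s ≤ dist z x ∧ dist z x ≤ s + δ})
  rcases le_total (dist z x) s with h | h
  · exact Or.inl h
  · exact Or.inr ⟨h, hz⟩

/-- If every spherical shell of width `δ` has `ρ`-mass at most `C`, then shifting the atoms of
an empirical measure by at most `δ` changes the mass of balls by at most `C` plus twice the
discrepancy to `ρ`. -/
theorem disc_empMeasure_le_of_annulus_le {E : Type*} [MeasurableSpace E] [PseudoMetricSpace E]
    [OpensMeasurableSpace E] {N : ℕ} (hN : 0 < N) {x y : Fin N → E} {δ C : ℝ} (hδ : 0 < δ)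
    (hxy : ∀ i, dist (x i) (y i) ≤ δ) (ρ : Measure E) [IsProbabilityMeasure ρ] (hC : 0 ≤ C)
    (hρ : ∀ (a : E) (s : ℝ), (ρ {z | s ≤ dist z a ∧ dist z a ≤ s + δ}).toReal ≤ C) :
    disc (empMeasure x) (empMeasure y) ≤ C + 2 * disc (empMeasure x) ρ := by
  have hμ := isProbabilityMeasure_empMeasure hN x
  have hν := isProbabilityMeasure_empMeasure hN y
  have hD := disc_nonneg (empMeasure x) ρ
  have hmeas (a : E) (r : ℝ) : MeasurableSet (closedBall a r) := isClosed_closedBall.measurableSet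
  refine disc_le (by positivity) fun a r hr => ?_
  have hr_le := abs_le.1 (abs_sub_le_disc (empMeasure x) ρ a hr)
  rw [abs_le]
  constructor
  · have h1 : (empMeasure y (closedBall a r)).toReal ≤
        (empMeasure x (closedBall a (r + δ))).toReal := by
      refine ENNReal.toReal_mono (measure_ne_top _ _)
        (empMeasure_mono (hmeas _ _) (hmeas _ _) fun i hi => ?_)
      have := dist_triangle (x i) (y i) a
      rw [mem_closedBall] at *
      linarith [hxy i]
    have h2 := abs_le.1 (abs_sub_le_disc (empMeasure x) ρ a (add_pos hr hδ))
    linarith [measureReal_closedBall_add_le_s6 ρ a r δ, hρ a r]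
  · rcases lt_or_ge δ r with hδr | hδr
    · have h1 : (empMeasure x (closedBall a (r - δ))).toReal ≤
          (empMeasure y (closedBall a r)).toReal := by
        refine ENNReal.toReal_mono (measure_ne_top _ _)
          (empMeasure_mono (hmeas _ _) (hmeas _ _) fun i hi => ?_)
        have := dist_triangle_left (y i) a (x i)
        rw [mem_closedBall] at *
        linarith [hxy i]
      have h2 := abs_le.1 (abs_sub_le_disc (empMeasure x) ρ a (sub_pos.2 hδr))
      have h3 := measureReal_closedBall_add_le_s6 ρ a (r - δ) δ
      rw [sub_add_cancel] at h3
      have h4 := hρ a (r - δ)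
      rw [sub_add_cancel] at h4
      linarith
    · have h1 : (ρ (closedBall a r)).toReal ≤ C := by
        refine le_trans (measureReal_mono fun z hz => ?_) (hρ a 0)
        exact ⟨dist_nonneg, (mem_closedBall.1 hz).trans (by linarith)⟩
      have h2 : 0 ≤ (empMeasure y (closedBall a r)).toReal := ENNReal.toReal_nonneg
      linarith

/-- If `μ^N`, `ν^N` are empirical measures of configurations at
mutual distance at most `δ`, then for any probability measure `ρ` with density
bounded by `B` and supported in `B_R`,
`D(μ^N,ν^N) ≤ c R^{d−1} δ B + c D(μ^N,ρ)`, where `c` depends only on `d`. -/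
theorem disc_emp_emp_bound (d : ℕ) :
    ∃ c : ℝ, 0 < c ∧
      ∀ (N : ℕ), 0 < N →
      ∀ (x y : Fin N → EuclideanSpace ℝ (Fin d)) (δ : ℝ), 0 < δ →
        (∀ i, dist (x i) (y i) ≤ δ) →
      ∀ (R B : ℝ), 0 < R → 0 < B →
      ∀ (ρ : Measure (EuclideanSpace ℝ (Fin d)))
        (f : EuclideanSpace ℝ (Fin d) → ℝ),
        IsProbabilityMeasure ρ →
        Measurable f → (∀ z, 0 ≤ f z) → (∀ᵐ z ∂volume, f z ≤ B) →
        ρ = volume.withDensity (fun z => ENNReal.ofReal (f z)) →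
        ρ (closedBall 0 R)ᶜ = 0 →
        disc (empMeasure x) (empMeasure y) ≤
          c * R ^ (d - 1) * δ * B + c * disc (empMeasure x) ρ := by
  cases d with
  | zero =>
    refine ⟨1, one_pos, fun N hN x y δ hδ _ R B hR hB ρ _ _ _ _ _ _ _ => ?_⟩
    have hD := disc_nonneg (empMeasure x) ρ
    obtain rfl : x = y := Subsingleton.elim _ _
    refine disc_le (by positivity) fun a r _ => ?_
    rw [sub_self, abs_zero]
    positivity
  | succ n =>
    refine ⟨2 * ((n : ℝ) + 1) ^ 2 * 2 ^ n + 2, by positivity,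
      fun N hN x y δ hδ hxy R B hR hB ρ f hprob _ _ hfB hρ hρR => ?_⟩
    have hD := disc_nonneg (empMeasure x) ρ
    refine (disc_empMeasure_le_of_annulus_le hN hδ hxy ρ (by positivity) fun a s =>
      withDensity_inter_annulus_le hR.le hB.le hδ.le hfB hρ hρR a).trans ?_
    rw [Nat.add_sub_cancel]
    gcongr
    · linarith
    · exact le_add_of_nonneg_left (by positivity)
end
end

section
/- For every R > 0 and every ε > 0 there exists δ > 0 such that for all probability measures μ and ν on ℝ^d supported in the closed ball B_R of radius R centered at the origin, D(μ,ν) < δ implies W₁(μ,ν) ≤ ε. In other words, on probability measures supported in a fixed compact ball, the 1-Wasserstein distance is continuous with respect to the discrepancy distance. -/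
open MeasureTheory Metric Set

noncomputable section

/-- The discrepancy bounds the difference of the masses of any closed ball. -/
theorem abs_sub_closedBall_le_disc {E : Type*} [MeasurableSpace E] [PseudoMetricSpace E]
    (μ ν : Measure E) [IsProbabilityMeasure μ] [IsProbabilityMeasure ν]
    (x : E) {r : ℝ} (hr : 0 < r) :
    |μ.real (closedBall x r) - ν.real (closedBall x r)| ≤ disc μ ν := by
  have h1 : ∀ (x : E) (r : ℝ),
      |(μ (closedBall x r)).toReal - (ν (closedBall x r)).toReal| ≤ 1 := fun x r =>
    abs_sub_le_of_nonneg_of_le ENNReal.toReal_nonneg (measureReal_le_one (μ := μ))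
      ENNReal.toReal_nonneg (measureReal_le_one (μ := ν))
  have h2 : ∀ (x : E) (r : ℝ),
      (⨆ _ : 0 < r, |(μ (closedBall x r)).toReal - (ν (closedBall x r)).toReal|) ≤ 1 :=
    fun x r => Real.iSup_le (fun _ => h1 x r) zero_le_one
  have h3 : ∀ x : E, (⨆ r : ℝ, ⨆ _ : 0 < r,
      |(μ (closedBall x r)).toReal - (ν (closedBall x r)).toReal|) ≤ 1 :=
    fun x => Real.iSup_le (h2 x) zero_le_one
  unfold disc
  refine le_ciSup_of_le ⟨1, forall_mem_range.2 h3⟩ x ?_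
  refine le_ciSup_of_le ⟨1, forall_mem_range.2 (h2 x)⟩ r ?_
  exact le_ciSup_of_le ⟨1, forall_mem_range.2 fun _ => h1 x r⟩ hr le_rfl

/-- Averaging a `1`-Lipschitz function over balls of radius `h` moves its integral against `μ` by
at most `h`, and the averaged integral only depends on the masses `μ (closedBall y h)`. -/
theorem abs_volume_mul_integral_sub_le {d : ℕ} {R h : ℝ}
    (μ : Measure (EuclideanSpace ℝ (Fin d))) [IsProbabilityMeasure μ]
    (hμ : μ (closedBall 0 R)ᶜ = 0)
    {ψ : EuclideanSpace ℝ (Fin d) → ℝ} (hψ : LipschitzWith 1 ψ) {C : ℝ} (hC : ∀ x, |ψ x| ≤ C) :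
    |volume.real (closedBall (0 : EuclideanSpace ℝ (Fin d)) h) * ∫ x, ψ x ∂μ -
      ∫ y in closedBall 0 (R + h), ψ y * μ.real (closedBall y h)| ≤
      volume.real (closedBall (0 : EuclideanSpace ℝ (Fin d)) h) * h := by
  set V := volume.real (closedBall (0 : EuclideanSpace ℝ (Fin d)) h) with hV
  have hvol : ∀ x : EuclideanSpace ℝ (Fin d), volume.real (closedBall x h) = V := fun x => by
    simp only [hV, Measure.real, Measure.addHaar_closedBall_center]
  have hfin : IsFiniteMeasure
      (volume.restrict (closedBall (0 : EuclideanSpace ℝ (Fin d)) (R + h))) :=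
    ⟨by simpa using measure_closedBall_lt_top⟩
  set lam := volume.restrict (closedBall (0 : EuclideanSpace ℝ (Fin d)) (R + h)) with hlam
  let S : Set (EuclideanSpace ℝ (Fin d) × EuclideanSpace ℝ (Fin d)) := {p | dist p.1 p.2 ≤ h}
  have hS : MeasurableSet S := (isClosed_le continuous_dist continuous_const).measurableSet
  let G : EuclideanSpace ℝ (Fin d) × EuclideanSpace ℝ (Fin d) → ℝ := S.indicator fun p => ψ p.2
  have hGm : Measurable G := (hψ.continuous.measurable.comp measurable_snd).indicator hS
  have hG : Integrable G (μ.prod lam) := by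
    refine Integrable.of_bound hGm.aestronglyMeasurable C (ae_of_all _ fun p => ?_)
    exact (norm_indicator_le_norm_self _ _).trans (hC _)
  have hψμ : Integrable ψ μ :=
    Integrable.of_bound hψ.continuous.aestronglyMeasurable C (ae_of_all _ hC)
  have hψl : ∀ x, IntegrableOn ψ (closedBall x h) := fun x =>
    hψ.continuous.continuousOn.integrableOn_compact (isCompact_closedBall x h)
  have hswap : ∫ y in closedBall 0 (R + h), ψ y * μ.real (closedBall y h)
      = ∫ x, ∫ y, G (x, y) ∂lam ∂μ := by
    rw [integral_integral_swap (f := fun x y => G (x, y)) hG]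
    refine integral_congr_ae (ae_of_all _ fun y => ?_)
    have : (fun x => G (x, y)) = (closedBall y h).indicator fun _ => ψ y := by
      ext x
      simp [G, S, indicator, mem_closedBall]
    simp only [this]
    rw [integral_indicator_const _ isClosed_closedBall.measurableSet, smul_eq_mul, mul_comm]
  have hsupp : ∀ᵐ x ∂μ, x ∈ closedBall (0 : EuclideanSpace ℝ (Fin d)) R := hμ
  have hpt : ∀ᵐ x ∂μ, ‖V * ψ x - ∫ y, G (x, y) ∂lam‖ ≤ V * h := by
    filter_upwards [hsupp] with x hx
    have hsub : closedBall x h ⊆ closedBall 0 (R + h) :=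
      closedBall_subset_closedBall' (by rw [mem_closedBall] at hx; linarith)
    have h1 : ∫ y, G (x, y) ∂lam = ∫ y in closedBall x h, ψ y := by
      have : (fun y => G (x, y)) = (closedBall x h).indicator ψ := by
        ext y
        simp [G, S, indicator, mem_closedBall, dist_comm]
      rw [this, integral_indicator isClosed_closedBall.measurableSet, hlam,
        Measure.restrict_restrict isClosed_closedBall.measurableSet,
        inter_eq_self_of_subset_left hsub]
    have h2 : V * ψ x = ∫ _ in closedBall x h, ψ x := by
      rw [setIntegral_const, hvol, smul_eq_mul]
    rw [h1, h2, ← integral_sub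
      (integrableOn_const (C := ψ x) (μ := volume) measure_closedBall_lt_top.ne) (hψl x)]
    refine (norm_setIntegral_le_of_norm_le_const (C := h) measure_closedBall_lt_top
      fun y hy => ?_).trans_eq (by rw [hvol, mul_comm])
    have := hψ.dist_le_mul x y
    rw [mem_closedBall, dist_comm] at hy
    rw [← dist_eq_norm]
    simpa using this.trans (by simpa using hy)
  rw [hswap, ← integral_const_mul,
    ← integral_sub (hψμ.const_mul V) hG.integral_prod_left]
  simpa using norm_integral_le_of_norm_le_const hpt

/-- On probability measures supported in a fixed ball `B_R` of `ℝ^d`,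
the `1`-Wasserstein distance is continuous w.r.t. the discrepancy distance:
for every `ε > 0` there is `δ > 0` such that `D(μ,ν) < δ` implies `W₁(μ,ν) ≤ ε`. -/
theorem W1_continuous_wrt_disc (d : ℕ) (R : ℝ) (hR : 0 < R) (ε : ℝ) (hε : 0 < ε) :
    ∃ δ : ℝ, 0 < δ ∧
      ∀ (μ ν : Measure (EuclideanSpace ℝ (Fin d))),
        IsProbabilityMeasure μ → IsProbabilityMeasure ν →
        μ (closedBall 0 R)ᶜ = 0 → ν (closedBall 0 R)ᶜ = 0 →
        disc μ ν < δ → W1 μ ν ≤ ε := by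
  set h := ε / 4 with hh_def
  have hh : 0 < h := by positivity
  set V := volume.real (closedBall (0 : EuclideanSpace ℝ (Fin d)) h) with hV
  set W := volume.real (closedBall (0 : EuclideanSpace ℝ (Fin d)) (R + h))
  have hVpos : 0 < V :=
    ENNReal.toReal_pos (measure_closedBall_pos _ _ hh).ne' measure_closedBall_lt_top.ne
  have hWpos : 0 < W :=
    ENNReal.toReal_pos (measure_closedBall_pos _ _ (by positivity)).ne'
      measure_closedBall_lt_top.ne
  refine ⟨V * (2 * h) / ((R + h) * W), by positivity, fun μ ν hμp hνp hμ hν hD => ?_⟩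
  rw [lt_div_iff₀ (by positivity)] at hD
  refine csSup_le ⟨0, fun _ => 0, LipschitzWith.const' 0, ⟨0, by simp⟩, by simp⟩ ?_
  rintro _ ⟨φ, hφ, ⟨C, hC⟩, rfl⟩
  have hφi : ∀ ρ : Measure (EuclideanSpace ℝ (Fin d)), IsProbabilityMeasure ρ →
      Integrable φ ρ := fun ρ _ =>
    Integrable.of_bound hφ.continuous.aestronglyMeasurable C (ae_of_all _ hC)
  let ψ := fun x => φ x - φ 0
  have hψ : LipschitzWith 1 ψ := LipschitzWith.of_dist_le_mul fun x y => by
    simpa [ψ] using hφ.dist_le_mul x y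
  have hψC : ∀ x, |ψ x| ≤ C + C := fun x => (abs_sub _ _).trans (add_le_add (hC x) (hC 0))
  have hψint : ∀ ρ : Measure (EuclideanSpace ℝ (Fin d)), IsProbabilityMeasure ρ →
      ∫ x, ψ x ∂ρ = ∫ x, φ x ∂ρ - φ 0 := fun ρ hρ => by
    rw [integral_sub (hφi ρ hρ) (integrable_const _)]
    simp
  have hbound : ∀ y ∈ closedBall (0 : EuclideanSpace ℝ (Fin d)) (R + h), |ψ y| ≤ R + h := by
    intro y hy
    have := hφ.dist_le_mul y 0
    rw [Real.dist_eq] at this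
    simpa [ψ] using this.trans (by simpa using hy)
  have hA := abs_le.1 (abs_volume_mul_integral_sub_le (h := h) μ hμ hψ hψC)
  have hB := abs_le.1 (abs_volume_mul_integral_sub_le (h := h) ν hν hψ hψC)
  rw [hψint μ hμp] at hA
  rw [hψint ν hνp] at hB
  have hint : ∀ ρ : Measure (EuclideanSpace ℝ (Fin d)), IsProbabilityMeasure ρ →
      IntegrableOn (fun y => ψ y * ρ.real (closedBall y h)) (closedBall 0 (R + h)) := by
    intro ρ _
    have hm : Measurable fun y => ρ.real (closedBall y h) := by
      have hS : MeasurableSet {p : EuclideanSpace ℝ (Fin d) × EuclideanSpace ℝ (Fin d) |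
          dist p.2 p.1 ≤ h} :=
        (isClosed_le (continuous_snd.dist continuous_fst) continuous_const).measurableSet
      exact (measurable_measure_prodMk_left hS).ennreal_toReal
    refine Measure.integrableOn_of_bounded (M := (C + C) * 1) measure_closedBall_lt_top.ne
      (hψ.continuous.measurable.mul hm).aestronglyMeasurable (ae_of_all _ fun y => ?_)
    rw [norm_mul]
    exact mul_le_mul (hψC y) (by simp [abs_of_nonneg measureReal_nonneg, measureReal_le_one])
      (norm_nonneg _) ((abs_nonneg _).trans (hψC y))
  have hdiff : (∫ y in closedBall 0 (R + h), ψ y * μ.real (closedBall y h)) -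
      ∫ y in closedBall 0 (R + h), ψ y * ν.real (closedBall y h) ≤ (R + h) * disc μ ν * W := by
    rw [← integral_sub (hint μ hμp) (hint ν hνp)]
    have hpt : ∀ y ∈ closedBall (0 : EuclideanSpace ℝ (Fin d)) (R + h),
        ‖ψ y * μ.real (closedBall y h) - ψ y * ν.real (closedBall y h)‖ ≤
          (R + h) * disc μ ν := fun y hy => by
      rw [← mul_sub, norm_mul]
      exact mul_le_mul (hbound y hy) (abs_sub_closedBall_le_disc μ ν y hh) (norm_nonneg _)
        (by positivity)
    exact (Real.le_norm_self _).trans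
      (norm_setIntegral_le_of_norm_le_const measure_closedBall_lt_top hpt)
  refine le_of_mul_le_mul_left ?_ hVpos
  have : ε = 4 * h := by rw [hh_def]; ring
  rw [this]
  linarith [hA.2, hB.1]
end
end

section
/- Let (X,V) = (x₁,…,x_N,v₁,…,v_N) ∈ ℝ^{Nd} × ℝ^{Nd} be a regular point, i.e. for every triad of distinct indices i, j, k one has |x_i − x_k| ≠ |x_j − x_k|. Then there exists τ > 0 such that the topological Cucker–Smale system Ẋ_i = V_i, V̇_i = (1/N) Σ_j K(M(X_i,|X_i − X_j|)) (V_j − V_i), with M(x,r) := (1/N) #{k : |X_k − x| ≤ r}, has a unique solution on (−τ,τ) with initial datum (X,V); moreover this solution is locally Lipschitz in t and in the initial datum (X,V). -/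
open MeasureTheory Metric Set
open scoped Classical

noncomputable section

/-- For a configuration `Y` of `N` points in `ℝ^d`, `M(p,r) = (1/N) #{k : |Y_k − p| ≤ r}`. -/
def Mpart {d N : ℕ} (Y : Fin N → EuclideanSpace ℝ (Fin d))
    (p : EuclideanSpace ℝ (Fin d)) (r : ℝ) : ℝ :=
  ((Finset.univ.filter fun k => dist (Y k) p ≤ r).card : ℝ) / N

/-- The topological Cucker–Smale interaction force on agent `i`:
`(1/N) Σ_j K(M(X_i,|X_i − X_j|)) (V_j − V_i)`. -/
def CSforce {d N : ℕ} (K : ℝ → ℝ)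
    (Y W : Fin N → EuclideanSpace ℝ (Fin d)) (i : Fin N) :
    EuclideanSpace ℝ (Fin d) :=
  (N : ℝ)⁻¹ • ∑ j : Fin N, K (Mpart Y (Y i) (dist (Y i) (Y j))) • (W j - W i)

/-- `Z` is a solution of the topological Cucker–Smale system on the set `s` of times. -/
def IsCSSol {d N : ℕ} (K : ℝ → ℝ) (s : Set ℝ)
    (Z : ℝ → (Fin N → EuclideanSpace ℝ (Fin d)) × (Fin N → EuclideanSpace ℝ (Fin d))) :
    Prop :=
  ∀ t ∈ s, ∀ i : Fin N,
    HasDerivAt (fun τ => (Z τ).1 i) ((Z t).2 i) t ∧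
    HasDerivAt (fun τ => (Z τ).2 i) (CSforce K (Z t).1 (Z t).2 i) t

/-- The constant-coefficient consensus operator with weights `a`. -/
def consensusCLM {d N : ℕ} (a : Fin N → Fin N → ℝ) :
    (Fin N → EuclideanSpace ℝ (Fin d)) →L[ℝ] (Fin N → EuclideanSpace ℝ (Fin d)) :=
  ContinuousLinearMap.pi fun i => (N : ℝ)⁻¹ • ∑ j : Fin N, a i j •
    (ContinuousLinearMap.proj (R := ℝ) (φ := fun _ : Fin N => EuclideanSpace ℝ (Fin d)) j -
      ContinuousLinearMap.proj (R := ℝ) (φ := fun _ : Fin N => EuclideanSpace ℝ (Fin d)) i)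

/-- The generator of the linear second-order system with consensus weights `a`. -/
def phaseCLM {d N : ℕ} (a : Fin N → Fin N → ℝ) :
    ((Fin N → EuclideanSpace ℝ (Fin d)) × (Fin N → EuclideanSpace ℝ (Fin d))) →L[ℝ]
      ((Fin N → EuclideanSpace ℝ (Fin d)) × (Fin N → EuclideanSpace ℝ (Fin d))) :=
  (ContinuousLinearMap.snd ℝ _ _).prod
    ((consensusCLM a).comp (ContinuousLinearMap.snd ℝ _ _))

/-- Near a regular configuration the ranks of distinct agents are constant. -/
lemma eventually_Mpart_eq {d N : ℕ} {x : Fin N → EuclideanSpace ℝ (Fin d)}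
    (hreg : ∀ i j k : Fin N, i ≠ j → j ≠ k → i ≠ k →
      dist (x i) (x k) ≠ dist (x j) (x k)) {i j : Fin N} (hij : i ≠ j) :
    ∀ᶠ Y in nhds x,
      Mpart Y (Y i) (dist (Y i) (Y j)) = Mpart x (x i) (dist (x i) (x j)) := by
  have key : ∀ k : Fin N, ∀ᶠ Y in nhds x,
      (dist (Y k) (Y i) ≤ dist (Y i) (Y j) ↔ dist (x k) (x i) ≤ dist (x i) (x j)) := by
    intro k
    by_cases hki : k = i
    · subst hki
      simp
    by_cases hkj : k = j
    · subst hkj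
      simp [dist_comm]
    have h1 : ContinuousAt (fun Y : Fin N → EuclideanSpace ℝ (Fin d) => dist (Y k) (Y i)) x := by
      fun_prop
    have h2 : ContinuousAt (fun Y : Fin N → EuclideanSpace ℝ (Fin d) => dist (Y i) (Y j)) x := by
      fun_prop
    have hne := hreg k j i hkj hij.symm hki
    rw [dist_comm (x j)] at hne
    rcases hne.lt_or_gt with h | h
    · filter_upwards [h1.eventually_lt h2 h] with Y hY
      exact iff_of_true hY.le h.le
    · filter_upwards [h2.eventually_lt h1 h] with Y hY
      exact iff_of_false hY.not_ge h.not_ge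
  filter_upwards [Filter.eventually_all.2 key] with Y hY
  simp only [Mpart, hY]

/-- Near a regular configuration the force is linear in the velocities. -/
lemma eventually_CSforce_eq {d N : ℕ} (K : ℝ → ℝ) {x : Fin N → EuclideanSpace ℝ (Fin d)}
    (hreg : ∀ i j k : Fin N, i ≠ j → j ≠ k → i ≠ k →
      dist (x i) (x k) ≠ dist (x j) (x k)) :
    ∀ᶠ Y in nhds x, ∀ W, CSforce K Y W =
      consensusCLM (fun i j => K (Mpart x (x i) (dist (x i) (x j)))) W := by
  have h : ∀ i j : Fin N, ∀ᶠ Y in nhds x, i ≠ j →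
      Mpart Y (Y i) (dist (Y i) (Y j)) = Mpart x (x i) (dist (x i) (x j)) := fun i j => by
    by_cases hij : i = j
    · simp [hij]
    · exact (eventually_Mpart_eq hreg hij).mono fun _ hY _ => hY
  filter_upwards [Filter.eventually_all.2 fun i => Filter.eventually_all.2 (h i)] with Y hY W
  ext1 i
  simp only [CSforce, consensusCLM, ContinuousLinearMap.coe_pi', smul_apply,
    sum_apply, sub_apply, ContinuousLinearMap.proj_apply]
  congr 1
  refine Finset.sum_congr rfl fun j _ => ?_
  by_cases hij : i = j
  · simp [hij]
  · rw [hY i j hij]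

/-- On an open set of positions where the force is a consensus operator, being a solution means
solving the linear system. -/
lemma isCSSol_iff_hasDerivAt {d N : ℕ} {K : ℝ → ℝ} {a : Fin N → Fin N → ℝ} {s : Set ℝ}
    {Z : ℝ → (Fin N → EuclideanSpace ℝ (Fin d)) × (Fin N → EuclideanSpace ℝ (Fin d))}
    (hZ : ∀ t ∈ s, CSforce K (Z t).1 (Z t).2 = consensusCLM a (Z t).2) :
    IsCSSol K s Z ↔ ∀ t ∈ s, HasDerivAt Z (phaseCLM a (Z t)) t := by
  refine forall₂_congr fun t ht => ?_
  have hp : phaseCLM a (Z t) = ((Z t).2, CSforce K (Z t).1 (Z t).2) := by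
    rw [hZ t ht]; rfl
  rw [hp, forall_and, ← hasDerivAt_pi (φ := fun τ i => (Z τ).1 i),
    ← hasDerivAt_pi (φ := fun τ i => (Z τ).2 i)]
  exact ⟨fun h => h.1.prodMk h.2, fun h => ⟨h.fst, h.snd⟩⟩

lemma IsCSSol.continuousAt {d N : ℕ} {K : ℝ → ℝ} {s : Set ℝ}
    {Z : ℝ → (Fin N → EuclideanSpace ℝ (Fin d)) × (Fin N → EuclideanSpace ℝ (Fin d))}
    (h : IsCSSol K s Z) {t : ℝ} (ht : t ∈ s) : ContinuousAt Z t :=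
  (continuousAt_pi.2 fun i => (h t ht i).1.continuousAt).prodMk
    (continuousAt_pi.2 fun i => (h t ht i).2.continuousAt)

/-- A solution that starts on a curve along which the force is locally a consensus operator
stays on it, provided that the curve solves the linear system. -/
lemma IsCSSol.eqOn_of_hasDerivAt {d N : ℕ} {K : ℝ → ℝ} {a : Fin N → Fin N → ℝ} {τ : ℝ}
    {U : Set (Fin N → EuclideanSpace ℝ (Fin d))} (hU : IsOpen U)
    (hUK : ∀ Y ∈ U, ∀ W, CSforce K Y W = consensusCLM a W)
    {Z F : ℝ → (Fin N → EuclideanSpace ℝ (Fin d)) × (Fin N → EuclideanSpace ℝ (Fin d))}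
    (hτ : 0 < τ) (hZ : IsCSSol K (Ioo (-τ) τ) Z) (h0 : Z 0 = F 0)
    (hF : ∀ t ∈ Ioo (-τ) τ, HasDerivAt F (phaseCLM a (F t)) t)
    (hFU : ∀ t ∈ Ioo (-τ) τ, (F t).1 ∈ U) :
    EqOn Z F (Ioo (-τ) τ) := by
  have hsub : Ioo (-τ) τ ⊆ {t | Z =ᶠ[nhds t] F} := by
    have hloc : ∀ t ∈ Ioo (-τ) τ, Z t = F t → Z =ᶠ[nhds t] F := by
      intro t ht heq
      have hI : ∀ᶠ r in nhds t, r ∈ Ioo (-τ) τ := isOpen_Ioo.mem_nhds ht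
      have hZU : ∀ᶠ r in nhds t, (Z r).1 ∈ U :=
        (continuous_fst.continuousAt.comp (hZ.continuousAt ht)).eventually_mem
          (hU.mem_nhds (by simpa [heq] using hFU t ht))
      refine ODE_solution_unique_of_eventually (v := fun _ => phaseCLM a) (s := fun _ => univ)
        (K := ‖phaseCLM (d := d) a‖₊)
        (Filter.Eventually.of_forall fun _ => (phaseCLM a).lipschitz.lipschitzOnWith) ?_ ?_ heq
      · filter_upwards [hI, hZU] with r hr hrU
        refine ⟨(isCSSol_iff_hasDerivAt (K := K) (s := {r}) ?_).1 ?_ r rfl, mem_univ _⟩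
        · rintro _ rfl
          exact hUK _ hrU _
        · rintro _ rfl
          exact hZ _ hr
      · filter_upwards [hI] with r hr
        exact ⟨hF r hr, mem_univ _⟩
    have h0I : (0 : ℝ) ∈ Ioo (-τ) τ := ⟨neg_lt_zero.2 hτ, hτ⟩
    refine isPreconnected_Ioo.subset_of_closure_inter_subset isOpen_setOfPred_eventually_nhds
      ⟨0, h0I, hloc 0 h0I h0⟩ ?_
    rintro t ⟨htc, ht⟩
    refine hloc t ht ?_
    by_contra hne
    have : ∀ᶠ r in nhds t, Z r ≠ F r :=
      ((hZ.continuousAt ht).ne_iff_eventually_ne (hF t ht).continuousAt).1 hne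
    obtain ⟨r, hr, hr'⟩ := mem_closure_iff_nhds.1 htc _ this
    exact hr hr'.self_of_nhds
  exact fun t ht => (hsub ht).self_of_nhds

/-- The flow of a bounded linear operator is smooth jointly in the initial datum and time. -/
lemma contDiff_exp_smul_apply {E : Type*} [NormedAddCommGroup E] [NormedSpace ℝ E]
    [CompleteSpace E] (A : E →L[ℝ] E) :
    ContDiff ℝ 1 fun q : E × ℝ => NormedSpace.exp (q.2 • A) q.1 := by
  have h : ContDiff ℝ 1 (NormedSpace.exp : (E →L[ℝ] E) → (E →L[ℝ] E)) := by
    exact AnalyticOnNhd.contDiff fun B _ => NormedSpace.exp_analytic B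
  exact (h.comp (contDiff_snd.smul contDiff_const)).clm_apply contDiff_fst

lemma exp_zero_smul_apply {E : Type*} [NormedAddCommGroup E] [NormedSpace ℝ E]
    [CompleteSpace E] (A : E →L[ℝ] E) (q : E) : NormedSpace.exp ((0 : ℝ) • A) q = q := by
  rw [zero_smul, NormedSpace.exp_zero, one_apply_eq_self]

lemma hasDerivAt_exp_smul_apply {E : Type*} [NormedAddCommGroup E] [NormedSpace ℝ E]
    [CompleteSpace E] (A : E →L[ℝ] E) (q : E) (t : ℝ) :
    HasDerivAt (fun r : ℝ => NormedSpace.exp (r • A) q) (A (NormedSpace.exp (t • A) q)) t := by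
  simpa using (hasDerivAt_exp_smul_const' A t).clm_apply (hasDerivAt_const t q)

/-- For a regular initial datum `(X,V)` (all iso-rank equalities
excluded), there is `τ > 0` such that the topological Cucker–Smale system has a
unique solution on `(−τ,τ)` with initial datum `(X,V)`; moreover the solution is
locally Lipschitz in `t` and in the initial datum. -/
theorem topological_CS_local_wellposedness {d N : ℕ} (K : ℝ → ℝ)
    (hKpos : ∀ z ∈ Set.Icc (0:ℝ) 1, 0 < K z)
    (hKanti : AntitoneOn K (Set.Icc (0:ℝ) 1))
    (LK : NNReal) (hKlip : LipschitzOnWith LK K (Set.Icc (0:ℝ) 1))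
    (x v : Fin N → EuclideanSpace ℝ (Fin d))
    (hreg : ∀ i j k : Fin N, i ≠ j → j ≠ k → i ≠ k →
      dist (x i) (x k) ≠ dist (x j) (x k)) :
    ∃ τ : ℝ, 0 < τ ∧
      (∃ Z, Z 0 = (x, v) ∧ IsCSSol K (Set.Ioo (-τ) τ) Z) ∧
      (∀ Z₁ Z₂, Z₁ 0 = (x, v) → Z₂ 0 = (x, v) →
        IsCSSol K (Set.Ioo (-τ) τ) Z₁ → IsCSSol K (Set.Ioo (-τ) τ) Z₂ →
        ∀ t ∈ Set.Ioo (-τ) τ, Z₁ t = Z₂ t) ∧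
      (∃ ε : ℝ, 0 < ε ∧
        ∃ Φ : (Fin N → EuclideanSpace ℝ (Fin d)) × (Fin N → EuclideanSpace ℝ (Fin d)) →
            ℝ → (Fin N → EuclideanSpace ℝ (Fin d)) × (Fin N → EuclideanSpace ℝ (Fin d)),
          (∀ q ∈ Metric.ball (x, v) ε, Φ q 0 = q ∧ IsCSSol K (Set.Ioo (-τ) τ) (Φ q)) ∧
          ∃ L : NNReal, LipschitzOnWith L (fun q => Φ q.1 q.2)
            (Metric.ball (x, v) ε ×ˢ Set.Ioo (-τ) τ)) := by
  obtain ⟨U, hUK, hU, hxU⟩ := _root_.eventually_nhds_iff.1 (eventually_CSforce_eq K hreg)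
  set A := phaseCLM (d := d) fun i j => K (Mpart x (x i) (dist (x i) (x j)))
  have hsmooth := contDiff_exp_smul_apply A
  obtain ⟨L, S, hS, hL⟩ := (hsmooth.contDiffAt (x := ((x, v), 0))).exists_lipschitzOnWith
  have hmem : ∀ᶠ q in nhds (((x, v), 0) :
      ((Fin N → EuclideanSpace ℝ (Fin d)) × (Fin N → EuclideanSpace ℝ (Fin d))) × ℝ),
      (NormedSpace.exp (q.2 • A) q.1).1 ∈ U :=
    (continuous_fst.comp hsmooth.continuous).continuousAt.eventually_mem
      (hU.mem_nhds (by simpa using hxU))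
  obtain ⟨δ, hδ, hball⟩ := Metric.mem_nhds_iff.1 (Filter.inter_mem hS hmem)
  rw [← ball_prod_same, Real.ball_eq_Ioo, zero_sub, zero_add] at hball
  have hd := fun q t => hasDerivAt_exp_smul_apply A q t
  have hsol : ∀ q ∈ ball (x, v) δ,
      IsCSSol K (Ioo (-δ) δ) fun t => NormedSpace.exp (t • A) q := fun q hq =>
    (isCSSol_iff_hasDerivAt fun t ht => hUK _ (hball (mk_mem_prod hq ht)).2 _).2
      fun t _ => hd q t
  have hc : (x, v) ∈ ball (x, v) δ := mem_ball_self hδ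
  have huniq : ∀ Z, Z 0 = (x, v) → IsCSSol K (Ioo (-δ) δ) Z →
      EqOn Z (fun t => NormedSpace.exp (t • A) (x, v)) (Ioo (-δ) δ) := fun Z h0 hZ =>
    hZ.eqOn_of_hasDerivAt hU hUK hδ (h0.trans (exp_zero_smul_apply A _).symm) (fun t _ => hd _ t)
      fun t ht => (hball (mk_mem_prod hc ht)).2
  exact ⟨δ, hδ, ⟨_, exp_zero_smul_apply A _, hsol _ hc⟩,
    fun Z₁ Z₂ h₁ h₂ hZ₁ hZ₂ t ht => (huniq Z₁ h₁ hZ₁ ht).trans (huniq Z₂ h₂ hZ₂ ht).symm,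
    δ, hδ, fun q t => NormedSpace.exp (t • A) q, fun q hq => ⟨exp_zero_smul_apply A q, hsol q hq⟩,
    L, hL.mono fun q hq => (hball hq).1⟩
end
end

section
/- Let f be a probability density on ℝ^d × ℝ^d whose spatial marginal Sf belongs to L^∞(ℝ^d) and is supported in B_{R_x}, and let ν₁, ν₂ be probability measures on ℝ^d × ℝ^d supported in B_{R_x} × B_{R_v}. Then there is a constant C, depending on R_x, R_v, ‖Sf‖_∞, the Lipschitz constant of K, ‖K‖_∞ and the dimension d, such that for all x ∈ B_{R_x} and all v with |v| ≤ R_v, |W[Sf,ν₁](x,v) − W[Sf,ν₂](x,v)| ≤ C W₁(ν₁,ν₂). -/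
open MeasureTheory Metric Set

noncomputable section

/-- `M[ρ](x,r) = ∫_{|x'−x| ≤ r} ρ(x') dx'`. -/
def Mdens {d : ℕ} (ρ : EuclideanSpace ℝ (Fin d) → ℝ)
    (x : EuclideanSpace ℝ (Fin d)) (r : ℝ) : ℝ :=
  ∫ y in closedBall x r, ρ y

/-- The spatial marginal `Sf(x) = ∫ f(x,v) dv`. -/
def Smarg {d : ℕ} (f : EuclideanSpace ℝ (Fin d) × EuclideanSpace ℝ (Fin d) → ℝ)
    (x : EuclideanSpace ℝ (Fin d)) : ℝ :=
  ∫ w, f (x, w)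

/-- The interaction field against a measure `ν`:
`W[ρ,ν](x,v) = ∫ K(M[ρ](x,|x−y|)) (w−v) dν(y,w)`. -/
def WfieldMeas {d : ℕ} (K : ℝ → ℝ) (ρ : EuclideanSpace ℝ (Fin d) → ℝ)
    (ν : Measure (EuclideanSpace ℝ (Fin d) × EuclideanSpace ℝ (Fin d)))
    (x v : EuclideanSpace ℝ (Fin d)) : EuclideanSpace ℝ (Fin d) :=
  ∫ p, K (Mdens ρ x (dist x p.1)) • (p.2 - v) ∂ν

section Wasserstein

variable {E : Type*} [MeasurableSpace E] [PseudoMetricSpace E] [BorelSpace E]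

/-- A bounded Lipschitz function is integrable against a finite measure. -/
lemma integrable_of_lipschitz_of_bounded {μ : Measure E} [IsFiniteMeasure μ] {φ : E → ℝ}
    {L : NNReal} (hφ : LipschitzWith L φ) {C : ℝ} (hC : ∀ x, |φ x| ≤ C) : Integrable φ μ :=
  Integrable.of_bound hφ.continuous.measurable.aestronglyMeasurable C
    (Filter.Eventually.of_forall hC)

/-- For probability measures carried by a bounded set, the set of values defining `W1` is
bounded above. -/
lemma W1_bddAbove {μ ν : Measure E} [IsProbabilityMeasure μ] [IsProbabilityMeasure ν] {S : Set E}
    (hS : Bornology.IsBounded S) (hμ : ∀ᵐ x ∂μ, x ∈ S) (hν : ∀ᵐ x ∂ν, x ∈ S) :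
    BddAbove {a : ℝ | ∃ φ : E → ℝ, LipschitzWith 1 φ ∧ (∃ C : ℝ, ∀ x, |φ x| ≤ C) ∧
      a = (∫ x, φ x ∂μ) - ∫ x, φ x ∂ν} := by
  obtain ⟨x₀, hx₀⟩ := hμ.exists
  refine ⟨2 * diam S, ?_⟩
  rintro a ⟨φ, hφ, ⟨C, hC⟩, rfl⟩
  have key : ∀ x ∈ S, |φ x - φ x₀| ≤ diam S := fun x hx => by
    have h := hφ.dist_le_mul x x₀
    rw [Real.dist_eq, NNReal.coe_one, one_mul] at h
    exact h.trans (dist_le_diam_of_mem hS hx hx₀)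
  have h1 : ∫ x, φ x ∂μ ≤ ∫ _, (φ x₀ + diam S) ∂μ :=
    integral_mono_ae (integrable_of_lipschitz_of_bounded hφ hC) (integrable_const _)
      (hμ.mono fun x hx => by have := (abs_le.1 (key x hx)).2; dsimp only; linarith)
  have h2 : ∫ _, (φ x₀ - diam S) ∂ν ≤ ∫ x, φ x ∂ν :=
    integral_mono_ae (integrable_const _) (integrable_of_lipschitz_of_bounded hφ hC)
      (hν.mono fun x hx => by have := (abs_le.1 (key x hx)).1; dsimp only; linarith)
  simp only [integral_const, probReal_univ, one_smul] at h1 h2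
  linarith

lemma W1_nonneg_s14 {μ ν : Measure E} [IsProbabilityMeasure μ] [IsProbabilityMeasure ν] {S : Set E}
    (hS : Bornology.IsBounded S) (hμ : ∀ᵐ x ∂μ, x ∈ S) (hν : ∀ᵐ x ∂ν, x ∈ S) :
    0 ≤ W1 μ ν :=
  le_csSup (W1_bddAbove hS hμ hν)
    ⟨fun _ => 0, LipschitzWith.const' 0, ⟨0, by simp⟩, by simp⟩

/-- Kantorovich duality bound for a real function that is Lipschitz on a bounded set carrying
both measures. -/
lemma integral_sub_integral_le_mul_W1 {μ ν : Measure E} [IsProbabilityMeasure μ]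
    [IsProbabilityMeasure ν] {S : Set E} (hS : Bornology.IsBounded S) (hμ : ∀ᵐ x ∂μ, x ∈ S)
    (hν : ∀ᵐ x ∂ν, x ∈ S) {g : E → ℝ} {L : NNReal} (hL : 0 < L) (hg : LipschitzOnWith L g S) :
    (∫ x, g x ∂μ) - ∫ x, g x ∂ν ≤ L * W1 μ ν := by
  obtain ⟨x₀, hx₀⟩ := hμ.exists
  obtain ⟨g', hg', heq⟩ := hg.extend_real
  set B : ℝ := |g' x₀| + L * diam S with hB
  have hB0 : 0 ≤ B := by positivity
  have hbound : ∀ x ∈ S, |g' x| ≤ B := fun x hx => by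
    have h := hg'.dist_le_mul x x₀
    rw [Real.dist_eq] at h
    have h2 : (L : ℝ) * dist x x₀ ≤ L * diam S := by
      gcongr
      exact dist_le_diam_of_mem hS hx hx₀
    have h3 := abs_sub_abs_le_abs_sub (g' x) (g' x₀)
    linarith
  set h : E → ℝ := fun x => max (-B) (min B (g' x)) with hh
  have hhLip : LipschitzWith L h := (hg'.const_min B).const_max (-B)
  have hhB : ∀ x, |h x| ≤ B := fun x =>
    abs_le.2 ⟨le_max_left _ _, max_le (by linarith) (min_le_left _ _)⟩
  have hhg : ∀ x ∈ S, g x = h x := fun x hx => by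
    have := abs_le.1 (hbound x hx)
    simp only [hh, heq hx, min_eq_right this.2, max_eq_right this.1]
  have hLr : (0 : ℝ) < L := hL
  have hmem : (L : ℝ)⁻¹ * ((∫ x, g x ∂μ) - ∫ x, g x ∂ν) ≤ W1 μ ν := by
    refine le_csSup (W1_bddAbove hS hμ hν) ⟨fun x => (L : ℝ)⁻¹ * h x, ?_, ?_, ?_⟩
    · refine LipschitzWith.of_dist_le_mul fun x y => ?_
      have := hhLip.dist_le_mul x y
      rw [Real.dist_eq] at this ⊢
      rw [← mul_sub, abs_mul, abs_of_pos (inv_pos.2 hLr), NNReal.coe_one, one_mul,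
        inv_mul_le_iff₀ hLr]
      exact this
    · refine ⟨(L : ℝ)⁻¹ * B, fun x => ?_⟩
      rw [abs_mul, abs_of_pos (inv_pos.2 hLr)]
      exact mul_le_mul_of_nonneg_left (hhB x) (inv_pos.2 hLr).le
    · rw [integral_congr_ae (hμ.mono hhg), integral_congr_ae (hν.mono hhg), integral_const_mul,
        integral_const_mul, mul_sub]
  rwa [inv_mul_le_iff₀ hLr] at hmem

/-- A function that is Lipschitz on a bounded measurable set carrying a finite measure is
integrable. -/
lemma integrable_of_lipschitzOn {V : Type*} [NormedAddCommGroup V] [SecondCountableTopology E]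
    {μ : Measure E} [IsFiniteMeasure μ] {S : Set E} (hS : Bornology.IsBounded S)
    (hSm : MeasurableSet S) (hμ : ∀ᵐ x ∂μ, x ∈ S) {F : E → V} {L : NNReal}
    (hF : LipschitzOnWith L F S) : Integrable F μ := by
  rcases S.eq_empty_or_nonempty with rfl | ⟨x₀, hx₀⟩
  · have : μ = 0 := by simpa using hμ
    simp [this]
  have hr : μ.restrict S = μ := Measure.restrict_eq_self_of_ae_mem hμ
  refine Integrable.of_bound (C := ‖F x₀‖ + L * diam S) ?_ (hμ.mono fun x hx => ?_)
  · rw [← hr]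
    exact hF.continuousOn.aestronglyMeasurable hSm
  · have h := hF.dist_le_mul x hx x₀ hx₀
    rw [dist_eq_norm] at h
    have h2 : (L : ℝ) * dist x x₀ ≤ L * diam S := by
      gcongr
      exact dist_le_diam_of_mem hS hx hx₀
    have h3 := norm_sub_norm_le (F x) (F x₀)
    linarith

/-- Vector-valued Kantorovich duality bound. -/
lemma norm_integral_sub_integral_le_mul_W1 {V : Type*} [NormedAddCommGroup V]
    [InnerProductSpace ℝ V] [CompleteSpace V] [SecondCountableTopology E] {μ ν : Measure E}
    [IsProbabilityMeasure μ] [IsProbabilityMeasure ν] {S : Set E} (hS : Bornology.IsBounded S)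
    (hSm : MeasurableSet S) (hμ : ∀ᵐ x ∂μ, x ∈ S) (hν : ∀ᵐ x ∂ν, x ∈ S) {F : E → V}
    {L : NNReal} (hL : 0 < L) (hF : LipschitzOnWith L F S) :
    ‖(∫ x, F x ∂μ) - ∫ x, F x ∂ν‖ ≤ L * W1 μ ν := by
  set D : V := (∫ x, F x ∂μ) - ∫ x, F x ∂ν with hD
  rcases eq_or_ne D 0 with h0 | h0
  · rw [h0, norm_zero]
    exact mul_nonneg L.coe_nonneg (W1_nonneg_s14 hS hμ hν)
  have hDpos : 0 < ‖D‖ := norm_pos_iff.2 h0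
  have hlip : LipschitzOnWith (‖D‖₊ * L) (fun x => inner ℝ D (F x)) S := by
    refine LipschitzOnWith.of_dist_le_mul fun x hx y hy => ?_
    have h := hF.dist_le_mul x hx y hy
    rw [dist_eq_norm] at h
    rw [Real.dist_eq, ← inner_sub_right, NNReal.coe_mul, coe_nnnorm, mul_assoc]
    exact (abs_real_inner_le_norm _ _).trans (by gcongr)
  have hkey := integral_sub_integral_le_mul_W1 hS hμ hν
    (mul_pos (nnnorm_pos.2 h0) hL) hlip
  rw [integral_inner (integrable_of_lipschitzOn hS hSm hμ hF),
    integral_inner (integrable_of_lipschitzOn hS hSm hν hF), ← inner_sub_right, ← hD,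
    real_inner_self_eq_norm_sq, NNReal.coe_mul, coe_nnnorm, mul_assoc, sq] at hkey
  exact le_of_mul_le_mul_left hkey hDpos

end Wasserstein

section Density

variable {d : ℕ} {ρ : EuclideanSpace ℝ (Fin d) → ℝ}

lemma Mdens_mem_Icc (hρ : Integrable ρ) (h0 : ∀ x, 0 ≤ ρ x) (h1 : ∫ x, ρ x = 1)
    (x : EuclideanSpace ℝ (Fin d)) (r : ℝ) : Mdens ρ x r ∈ Icc (0 : ℝ) 1 :=
  ⟨integral_nonneg h0,
    h1 ▸ setIntegral_le_integral hρ (Filter.Eventually.of_forall h0)⟩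

/-- The mass of a ball under a bounded density grows at most like the volume of the ball. -/
lemma Mdens_sub_le {B : ℝ} (hρ : Integrable ρ) (hB : ∀ x, ρ x ≤ B)
    (x : EuclideanSpace ℝ (Fin d)) {r s : ℝ} (hr : 0 ≤ r) (hrs : r ≤ s) :
    Mdens ρ x s - Mdens ρ x r ≤
      B * (volume.real (ball (0 : EuclideanSpace ℝ (Fin d)) 1) * (s ^ d - r ^ d)) := by
  have hsub : closedBall x r ⊆ closedBall x s := closedBall_subset_closedBall hrs
  have hvol : ∀ t : ℝ, 0 ≤ t → volume.real (closedBall x t) =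
      t ^ d * volume.real (ball (0 : EuclideanSpace ℝ (Fin d)) 1) := fun t ht => by
    rw [Measure.addHaar_real_closedBall volume x ht, finrank_euclideanSpace_fin]
  have hfin : volume (closedBall x s \ closedBall x r) ≠ ⊤ :=
    measure_ne_top_of_subset sdiff_subset measure_closedBall_lt_top.ne
  unfold Mdens
  rw [← setIntegral_sdiff measurableSet_closedBall hρ.integrableOn hsub]
  calc ∫ y in closedBall x s \ closedBall x r, ρ y
      ≤ ∫ _ in closedBall x s \ closedBall x r, B :=
        setIntegral_mono hρ.integrableOn (integrableOn_const hfin) hB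
    _ = B * (volume.real (ball (0 : EuclideanSpace ℝ (Fin d)) 1) * (s ^ d - r ^ d)) := by
        rw [setIntegral_const, smul_eq_mul,
          measureReal_sdiff hsub measurableSet_closedBall measure_closedBall_lt_top.ne,
          hvol s (hr.trans hrs), hvol r hr]
        ring

/-- Under a bounded density, the mass of a ball of bounded radius is Lipschitz in the radius. -/
lemma abs_Mdens_sub_le {B : ℝ} (hB0 : 0 ≤ B) (hρ : Integrable ρ) (h0 : ∀ x, 0 ≤ ρ x)
    (hB : ∀ x, ρ x ≤ B) (x : EuclideanSpace ℝ (Fin d)) {R r s : ℝ} (hr : r ∈ Icc 0 R)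
    (hs : s ∈ Icc 0 R) :
    |Mdens ρ x s - Mdens ρ x r| ≤
      B * (volume.real (ball (0 : EuclideanSpace ℝ (Fin d)) 1) * (d * R ^ (d - 1))) * |s - r| := by
  wlog hrs : r ≤ s generalizing r s
  · rw [abs_sub_comm, abs_sub_comm s r]
    exact this hs hr (le_of_not_ge hrs)
  have hmono : Mdens ρ x r ≤ Mdens ρ x s :=
    setIntegral_mono_set hρ.integrableOn (Filter.Eventually.of_forall h0)
      (closedBall_subset_closedBall hrs).eventuallyLE
  rw [abs_of_nonneg (sub_nonneg.2 hmono), abs_of_nonneg (sub_nonneg.2 hrs)]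
  have hpow : s ^ d - r ^ d ≤ d * R ^ (d - 1) * (s - r) := by
    have h := abs_pow_sub_pow_le s r d
    rw [abs_of_nonneg (sub_nonneg.2 hrs), abs_of_nonneg hs.1, abs_of_nonneg hr.1,
      max_eq_left hrs] at h
    calc s ^ d - r ^ d ≤ (s - r) * d * s ^ (d - 1) := (le_abs_self _).trans h
      _ ≤ (s - r) * d * R ^ (d - 1) := by
        have := sub_nonneg.2 hrs
        have := hs.1
        gcongr
        exact hs.2
      _ = d * R ^ (d - 1) * (s - r) := by ring
  calc Mdens ρ x s - Mdens ρ x r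
      ≤ B * (volume.real (ball (0 : EuclideanSpace ℝ (Fin d)) 1) * (s ^ d - r ^ d)) :=
        Mdens_sub_le hρ hB x hr.1 hrs
    _ ≤ B * (volume.real (ball (0 : EuclideanSpace ℝ (Fin d)) 1) *
          (d * R ^ (d - 1) * (s - r))) := by gcongr
    _ = _ := by ring

end Density

/-- For a probability density `f` with bounded, compactly supported
spatial marginal `Sf`, the field `ν ↦ W[Sf,ν]` is weakly continuous:
`‖W[Sf,ν₁](x,v) − W[Sf,ν₂](x,v)‖ ≤ C W₁(ν₁,ν₂)` uniformly on `B_{R_x} × B_{R_v}`,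
for `ν₁, ν₂` supported in `B_{R_x} × B_{R_v}`. -/
theorem Wfield_weakly_continuous {d : ℕ} (K : ℝ → ℝ)
    (hKpos : ∀ z ∈ Set.Icc (0:ℝ) 1, 0 < K z)
    (hKanti : AntitoneOn K (Set.Icc (0:ℝ) 1))
    (LK : NNReal) (hKlip : LipschitzOnWith LK K (Set.Icc (0:ℝ) 1))
    (Ksup : ℝ) (hKsup : ∀ z ∈ Set.Icc (0:ℝ) 1, |K z| ≤ Ksup)
    (Rx Rv SB : ℝ) (hRx : 0 < Rx) (hRv : 0 < Rv) (hSBpos : 0 < SB) :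
    ∃ C : ℝ, 0 < C ∧
      ∀ (f : EuclideanSpace ℝ (Fin d) × EuclideanSpace ℝ (Fin d) → ℝ),
        Measurable f → (∀ p, 0 ≤ f p) → (∫ p, f p) = 1 →
        (∀ x, Smarg f x ≤ SB) →
        (∀ x, Smarg f x ≠ 0 → x ∈ closedBall (0 : EuclideanSpace ℝ (Fin d)) Rx) →
      ∀ (ν₁ ν₂ : Measure (EuclideanSpace ℝ (Fin d) × EuclideanSpace ℝ (Fin d))),
        IsProbabilityMeasure ν₁ → IsProbabilityMeasure ν₂ →
        ν₁ (closedBall (0 : EuclideanSpace ℝ (Fin d)) Rx ×ˢ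
            closedBall (0 : EuclideanSpace ℝ (Fin d)) Rv)ᶜ = 0 →
        ν₂ (closedBall (0 : EuclideanSpace ℝ (Fin d)) Rx ×ˢ
            closedBall (0 : EuclideanSpace ℝ (Fin d)) Rv)ᶜ = 0 →
      ∀ (x v : EuclideanSpace ℝ (Fin d)),
        x ∈ closedBall (0 : EuclideanSpace ℝ (Fin d)) Rx → ‖v‖ ≤ Rv →
        ‖WfieldMeas K (Smarg f) ν₁ x v - WfieldMeas K (Smarg f) ν₂ x v‖ ≤
          C * W1 ν₁ ν₂ := by
  set A : ℝ := SB * (volume.real (ball (0 : EuclideanSpace ℝ (Fin d)) 1) *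
    (d * (2 * Rx) ^ (d - 1))) with hA
  have hA0 : 0 ≤ A := by positivity
  have hKs0 : 0 ≤ Ksup := (abs_nonneg _).trans (hKsup 0 (by simp))
  have hC0 : 0 < LK * A * (2 * Rv) + Ksup + 1 := by positivity
  refine ⟨LK * A * (2 * Rv) + Ksup + 1, hC0, ?_⟩
  intro f _ hf0 hf1 hSB _ ν₁ ν₂ _ _ hν₁ hν₂ x v hx hv
  have hfint : Integrable f := by
    by_contra h
    simp [integral_undef h] at hf1
  rw [Measure.volume_eq_prod] at hfint hf1
  have hρint : Integrable (Smarg f) := hfint.integral_prod_left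
  have hρ0 : ∀ y, 0 ≤ Smarg f y := fun y => integral_nonneg fun w => hf0 (y, w)
  have hρ1 : ∫ y, Smarg f y = 1 := by
    rw [← hf1, integral_prod f hfint]
    rfl
  refine norm_integral_sub_integral_le_mul_W1 (L := ⟨_, hC0.le⟩)
    (isBounded_closedBall.prod isBounded_closedBall)
    (measurableSet_closedBall.prod measurableSet_closedBall)
    (mem_ae_iff.2 hν₁) (mem_ae_iff.2 hν₂) hC0
    (LipschitzOnWith.of_dist_le_mul fun p hp q hq => ?_)
  have hradius : ∀ y ∈ closedBall (0 : EuclideanSpace ℝ (Fin d)) Rx,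
      dist x y ∈ Icc 0 (2 * Rx) := fun y hy => by
    refine ⟨dist_nonneg, (dist_triangle_right x y 0).trans ?_⟩
    rw [mem_closedBall] at hx hy
    linarith
  have hM := abs_Mdens_sub_le hSBpos.le hρint hρ0 hSB x (hradius q.1 hq.1) (hradius p.1 hp.1)
  rw [← hA] at hM
  have hdist1 : |dist x p.1 - dist x q.1| ≤ dist p q := by
    rw [dist_comm x, dist_comm x]
    exact (abs_dist_sub_le _ _ _).trans (le_max_left _ _)
  have hdist2 : ‖p.2 - q.2‖ ≤ dist p q := by
    rw [← dist_eq_norm]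
    exact le_max_right _ _
  set a := Mdens (Smarg f) x (dist x p.1)
  set b := Mdens (Smarg f) x (dist x q.1)
  have ha : a ∈ Icc (0 : ℝ) 1 := Mdens_mem_Icc hρint hρ0 hρ1 _ _
  have hb : b ∈ Icc (0 : ℝ) 1 := Mdens_mem_Icc hρint hρ0 hρ1 _ _
  have hK : |K a - K b| ≤ LK * A * dist p q := by
    have h := hKlip.dist_le_mul a ha b hb
    rw [Real.dist_eq, Real.dist_eq] at h
    calc |K a - K b| ≤ LK * |a - b| := h
      _ ≤ LK * (A * dist p q) := by
        gcongr
        exact hM.trans (by gcongr)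
      _ = LK * A * dist p q := by ring
  have hpv : ‖p.2 - v‖ ≤ 2 * Rv := by
    have h1 := mem_closedBall_zero_iff.1 hp.2
    have h2 := norm_sub_le p.2 v
    linarith
  have hsplit : K a • (p.2 - v) - K b • (q.2 - v) =
      (K a - K b) • (p.2 - v) + K b • (p.2 - q.2) := by module
  rw [dist_eq_norm (K a • (p.2 - v)), hsplit]
  calc ‖(K a - K b) • (p.2 - v) + K b • (p.2 - q.2)‖
      ≤ |K a - K b| * ‖p.2 - v‖ + |K b| * ‖p.2 - q.2‖ := by
        refine (norm_add_le _ _).trans_eq ?_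
        rw [norm_smul, norm_smul, Real.norm_eq_abs, Real.norm_eq_abs]
    _ ≤ LK * A * dist p q * (2 * Rv) + Ksup * dist p q := by
        gcongr
        exact hKsup b hb
    _ ≤ (LK * A * (2 * Rv) + Ksup + 1) * dist p q := by
        have : 0 ≤ dist p q := dist_nonneg
        linarith
end
end

section
/- Let {f_t}_{t ≥ 0} be a family of probability densities on ℝ^d × ℝ^d, weakly continuous in t in the sense of measures, with ‖f_t‖_∞ ≤ r(t) for a continuous non-decreasing function r, and with supp(f_t) ⊂ B_{R_x(t)} × B_{R_v(t)} for continuous non-decreasing functions R_x(t), R_v(t). Then for any initial datum (x,v) ∈ ℝ^d × ℝ^d there exists a unique global solution (X_t(x,v), V_t(x,v)) of the characteristic system Ẋ_t = V_t, V̇_t = W[Sf_t, f_t](X_t, V_t), X₀ = x, V₀ = v. -/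
open MeasureTheory Metric Set

noncomputable section

/-- The interaction field
`W[ρ,f](x,v) = ∫ K(M[ρ](x,|x−y|)) (w−v) f(y,w) dy dw`. -/
def Wfield {d : ℕ} (K : ℝ → ℝ) (ρ : EuclideanSpace ℝ (Fin d) → ℝ)
    (f : EuclideanSpace ℝ (Fin d) × EuclideanSpace ℝ (Fin d) → ℝ)
    (x v : EuclideanSpace ℝ (Fin d)) : EuclideanSpace ℝ (Fin d) :=
  ∫ p : EuclideanSpace ℝ (Fin d) × EuclideanSpace ℝ (Fin d),
    (K (Mdens ρ x (dist x p.1)) * f p) • (p.2 - v)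

section GlobalODE

open scoped NNReal

variable {E : Type*} [NormedAddCommGroup E]

/-- A radial cutoff, equal to `1` on the ball of radius `A` and to `0` off the ball of
radius `A + 1`. -/
def radialCutoff (A : ℝ) (z : E) : ℝ := max 0 (min 1 (A + 1 - ‖z‖))

theorem radialCutoff_nonneg (A : ℝ) (z : E) : 0 ≤ radialCutoff A z := le_max_left _ _

theorem radialCutoff_le_one (A : ℝ) (z : E) : radialCutoff A z ≤ 1 :=
  max_le zero_le_one (min_le_left _ _)

theorem radialCutoff_eq_one {A : ℝ} {z : E} (h : ‖z‖ ≤ A) : radialCutoff A z = 1 := by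
  rw [radialCutoff, min_eq_left (by linarith), max_eq_right zero_le_one]

theorem radialCutoff_eq_zero {A : ℝ} {z : E} (h : A + 1 ≤ ‖z‖) : radialCutoff A z = 0 :=
  max_eq_left ((min_le_right _ _).trans (by linarith))

theorem continuous_radialCutoff (A : ℝ) : Continuous (radialCutoff A : E → ℝ) := by
  unfold radialCutoff; fun_prop

theorem abs_radialCutoff_sub_le (A : ℝ) (z w : E) :
    |radialCutoff A z - radialCutoff A w| ≤ ‖z - w‖ := by
  have h : |(A + 1 - ‖z‖) - (A + 1 - ‖w‖)| ≤ ‖z - w‖ := by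
    rw [sub_sub_sub_cancel_left, norm_sub_rev]
    exact abs_norm_sub_norm_le w z
  refine le_trans ?_ h
  rw [radialCutoff, radialCutoff, max_comm, max_comm 0]
  refine (abs_max_sub_max_le_abs _ _ _).trans ?_
  exact (abs_min_sub_min_le_max _ _ _ _).trans (by simp)

variable [NormedSpace ℝ E]

theorem norm_radialCutoff_smul_le (A : ℝ) (z y : E) : ‖radialCutoff A z • y‖ ≤ ‖y‖ := by
  rw [norm_smul, Real.norm_of_nonneg (radialCutoff_nonneg A z)]
  exact mul_le_of_le_one_left (norm_nonneg _) (radialCutoff_le_one A z)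

theorem norm_radialCutoff_smul_self_le {A : ℝ} (hA : 0 ≤ A) (z : E) :
    ‖radialCutoff A z • z‖ ≤ A + 1 := by
  rcases le_total ‖z‖ (A + 1) with h | h
  · exact (norm_radialCutoff_smul_le A z z).trans h
  · rw [radialCutoff_eq_zero h, zero_smul, norm_zero]; positivity

theorem LipschitzOnWith.radialCutoff_smul {F : E → E} {s : Set E} {L B : ℝ≥0}
    (hF : LipschitzOnWith L F s) (hB : ∀ z ∈ s, ‖F z‖ ≤ B) (A : ℝ) :
    LipschitzOnWith (L + B) (fun z => radialCutoff A z • F z) s := by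
  refine LipschitzOnWith.of_dist_le_mul fun z hz w hw => ?_
  rw [dist_eq_norm, dist_eq_norm]
  have hLip := hF.dist_le_mul z hz w hw
  rw [dist_eq_norm, dist_eq_norm] at hLip
  have key : radialCutoff A z • F z - radialCutoff A w • F w
      = radialCutoff A z • (F z - F w) + (radialCutoff A z - radialCutoff A w) • F w := by
    module
  rw [key]
  calc _ ≤ ‖F z - F w‖ + ‖z - w‖ * B := by
        refine (norm_add_le _ _).trans (add_le_add ?_ ?_)
        · rw [norm_smul, Real.norm_of_nonneg (radialCutoff_nonneg A z)]
          exact mul_le_of_le_one_left (norm_nonneg _) (radialCutoff_le_one A z)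
        · rw [norm_smul, Real.norm_eq_abs]
          exact mul_le_mul (abs_radialCutoff_sub_le A z w) (hB w hw) (norm_nonneg _)
            (norm_nonneg _)
    _ ≤ _ := by push_cast; linarith

variable {F : ℝ → E → E}

/-- Forward uniqueness for a locally Lipschitz time-dependent vector field. -/
theorem eqOn_Icc_of_hasDerivWithinAt {T : ℝ}
    (hlip : ∀ R : ℝ, 0 ≤ R → ∃ L : ℝ≥0, ∀ t ∈ Icc 0 T, LipschitzOnWith L (F t) (closedBall 0 R))
    {Y Z : ℝ → E} (h0 : Y 0 = Z 0)
    (hY : ∀ t ∈ Icc 0 T, HasDerivWithinAt Y (F t (Y t)) (Icc 0 T) t)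
    (hZ : ∀ t ∈ Icc 0 T, HasDerivWithinAt Z (F t (Z t)) (Icc 0 T) t) :
    EqOn Y Z (Icc 0 T) := by
  have hYc : ContinuousOn Y (Icc 0 T) := fun t ht => (hY t ht).continuousWithinAt
  have hZc : ContinuousOn Z (Icc 0 T) := fun t ht => (hZ t ht).continuousWithinAt
  obtain ⟨R₁, hR₁⟩ := isCompact_Icc.exists_bound_of_continuousOn hYc
  obtain ⟨R₂, hR₂⟩ := isCompact_Icc.exists_bound_of_continuousOn hZc
  obtain ⟨L, hL⟩ := hlip (max 0 (max R₁ R₂)) (le_max_left _ _)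
  have right : ∀ {X : ℝ → E}, (∀ t ∈ Icc 0 T, HasDerivWithinAt X (F t (X t)) (Icc 0 T) t) →
      ∀ t ∈ Ico 0 T, HasDerivWithinAt X (F t (X t)) (Ici t) t := fun h t ht =>
    (h t (Ico_subset_Icc_self ht)).mono_of_mem_nhdsWithin (Icc_mem_nhdsGE_of_mem ht)
  refine ODE_solution_unique_of_mem_Icc_right (s := fun _ => closedBall 0 (max 0 (max R₁ R₂)))
    (fun t ht => hL t (Ico_subset_Icc_self ht)) hYc (right hY) (fun t ht => ?_) hZc (right hZ)
    (fun t ht => ?_) h0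
  · rw [mem_closedBall_zero_iff]
    exact (hR₁ t (Ico_subset_Icc_self ht)).trans
      ((le_max_left _ _).trans (le_max_right _ _))
  · rw [mem_closedBall_zero_iff]
    exact (hR₂ t (Ico_subset_Icc_self ht)).trans
      ((le_max_right _ _).trans (le_max_right _ _))

/-- Existence on a given time interval under a local Lipschitz condition and linear growth. -/
theorem exists_hasDerivWithinAt_Icc_of_linear_growth [CompleteSpace E] {T : ℝ} (hT : 0 ≤ T)
    (hcont : ∀ z, ContinuousOn (fun t => F t z) (Icc 0 T))
    (hlip : ∀ R : ℝ, 0 ≤ R → ∃ L : ℝ≥0, ∀ t ∈ Icc 0 T, LipschitzOnWith L (F t) (closedBall 0 R))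
    {C : ℝ} (hC : 0 ≤ C) (hgrow : ∀ t ∈ Icc 0 T, ∀ z, ‖F t z‖ ≤ C * ‖z‖ + C) (z₀ : E) :
    ∃ Z : ℝ → E, Z 0 = z₀ ∧ ∀ t ∈ Icc 0 T, HasDerivWithinAt Z (F t (Z t)) (Icc 0 T) t := by
  set A : ℝ := gronwallBound ‖z₀‖ C C T
  have hmono := gronwallBound_mono (norm_nonneg z₀) hC hC
  have hA : 0 ≤ A := by
    have := hmono hT
    rw [gronwallBound_x0] at this
    exact (norm_nonneg _).trans this
  set G : ℝ → E → E := fun t z => radialCutoff A z • F t z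
  have hGF : ∀ t z, ‖G t z‖ ≤ ‖F t z‖ := fun t z => norm_radialCutoff_smul_le A z _
  let M : ℝ≥0 := ⟨C * (A + 1) + C, by positivity⟩
  let a : ℝ≥0 := M * ⟨T, hT⟩
  let R : ℝ≥0 := ⟨‖z₀‖ + a, by positivity⟩
  let B : ℝ≥0 := ⟨C * R + C, by positivity⟩
  obtain ⟨L, hL⟩ := hlip R R.2
  have hsub : closedBall z₀ (a : ℝ) ⊆ closedBall 0 (R : ℝ) :=
    closedBall_subset_closedBall' (by rw [dist_zero_right]; exact (add_comm _ _).le)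
  have hPL : IsPicardLindelof G (⟨0, left_mem_Icc.2 hT⟩ : Icc 0 T) z₀ a 0 M (L + B) :=
    { lipschitzOnWith := fun t ht => ((hL t ht).mono hsub).radialCutoff_smul (fun z hz => by
        have hz' := mem_closedBall_zero_iff.1 (hsub hz)
        refine (hgrow t ht z).trans ?_
        change C * ‖z‖ + C ≤ C * R + C
        gcongr) A
      continuousOn := fun z _ => (hcont z).const_smul _
      norm_le := fun t ht z _ => by
        change _ ≤ C * (A + 1) + C
        rcases le_total ‖z‖ (A + 1) with h | h
        · refine ((hGF t z).trans (hgrow t ht z)).trans ?_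
          gcongr
        · simp only [G, radialCutoff_eq_zero h, zero_smul, norm_zero]
          positivity
      mul_max_le := by simp [a, hT]; rfl }
  obtain ⟨Z, hZ0, hZ⟩ := hPL.exists_eq_forall_mem_Icc_hasDerivWithinAt₀
  refine ⟨Z, hZ0, fun t ht => ?_⟩
  have hbound := norm_le_gronwallBound_of_norm_deriv_right_le (δ := ‖z₀‖) (K := C) (ε := C)
    (fun t ht => (hZ t ht).continuousWithinAt)
    (fun t ht => (hZ t (Ico_subset_Icc_self ht)).mono_of_mem_nhdsWithin
      (Icc_mem_nhdsGE_of_mem ht))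
    (by rw [← hZ0]) (fun t ht => (hGF t (Z t)).trans (hgrow t (Ico_subset_Icc_self ht) _)) t ht
  have := hZ t ht
  simp only [G] at this
  rwa [radialCutoff_eq_one (hbound.trans (hmono (by linarith [ht.2]))), one_smul] at this

/-- Global forward existence and uniqueness for a time-dependent vector field that is locally
Lipschitz in space with at most linear growth, locally uniformly in time. -/
theorem existsUnique_global_of_linear_growth [CompleteSpace E]
    (hcont : ∀ z, ContinuousOn (fun t => F t z) (Ici 0))
    (hlip : ∀ T R : ℝ, 0 ≤ R →
      ∃ L : ℝ≥0, ∀ t ∈ Icc 0 T, LipschitzOnWith L (F t) (closedBall 0 R))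
    (hgrow : ∀ T : ℝ, ∃ C : ℝ, 0 ≤ C ∧ ∀ t ∈ Icc 0 T, ∀ z, ‖F t z‖ ≤ C * ‖z‖ + C) (z₀ : E) :
    ∃ Z : ℝ → E, Z 0 = z₀ ∧
      (∀ t ∈ Ici (0 : ℝ), HasDerivWithinAt Z (F t (Z t)) (Ici 0) t) ∧
      ∀ Z' : ℝ → E, Z' 0 = z₀ →
        (∀ t ∈ Ici (0 : ℝ), HasDerivWithinAt Z' (F t (Z' t)) (Ici 0) t) →
        EqOn Z' Z (Ici 0) := by
  have hex : ∀ n : ℕ, ∃ Z : ℝ → E, Z 0 = z₀ ∧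
      ∀ t ∈ Icc 0 (n : ℝ), HasDerivWithinAt Z (F t (Z t)) (Icc 0 n) t := fun n => by
    obtain ⟨C, hC, hCg⟩ := hgrow n
    exact exists_hasDerivWithinAt_Icc_of_linear_growth n.cast_nonneg
      (fun z => (hcont z).mono Icc_subset_Ici_self) (hlip n) hC hCg z₀
  choose Y hY0 hY using hex
  have hmono : ∀ {m n : ℕ}, m ≤ n → EqOn (Y m) (Y n) (Icc 0 m) := fun {m n} hmn => by
    have hsub : Icc (0 : ℝ) m ⊆ Icc 0 n := Icc_subset_Icc_right (by exact_mod_cast hmn)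
    exact eqOn_Icc_of_hasDerivWithinAt (hlip m) ((hY0 m).trans (hY0 n).symm) (hY m)
      fun t ht => (hY n t (hsub ht)).mono hsub
  have hglue : ∀ n : ℕ, EqOn (fun t => Y ⌈t⌉₊ t) (Y n) (Icc 0 n) := fun n t ht =>
    hmono (Nat.ceil_le.2 ht.2) ⟨ht.1, Nat.le_ceil t⟩
  have hderiv : ∀ t ∈ Ici (0 : ℝ),
      HasDerivWithinAt (fun t => Y ⌈t⌉₊ t) (F t (Y ⌈t⌉₊ t)) (Ici 0) t := fun t ht => by
    set n := ⌈t⌉₊ + 1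
    have htn : t < n := (Nat.le_ceil t).trans_lt (by simp [n])
    have htI : t ∈ Icc (0 : ℝ) n := ⟨ht, htn.le⟩
    have hd := (hY n t htI).congr (hglue n) (hglue n htI)
    rw [← hglue n htI] at hd
    refine hd.mono_of_mem_nhdsWithin ?_
    rw [← Ici_inter_Iic]
    exact Filter.inter_mem self_mem_nhdsWithin (mem_nhdsWithin_of_mem_nhds (Iic_mem_nhds htn))
  refine ⟨fun t => Y ⌈t⌉₊ t, ?_, hderiv, fun Z' hZ'0 hZ' t ht => ?_⟩
  · simp [hY0]
  · refine eqOn_Icc_of_hasDerivWithinAt (T := t) (hlip t) ?_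
      (fun s hs => (hZ' s hs.1).mono Icc_subset_Ici_self)
      (fun s hs => (hderiv s hs.1).mono Icc_subset_Ici_self) ⟨ht, le_rfl⟩
    simp [hY0, hZ'0]

end GlobalODE

section MeanField

open Filter Topology
open scoped NNReal

variable {d : ℕ}

/-- A probability density on phase space bounded by `c` and supported in the product of the
centered balls of radii `R₁` (positions) and `R₂` (velocities). -/
structure IsBoundedDensity (c R₁ R₂ : ℝ)
    (f : EuclideanSpace ℝ (Fin d) × EuclideanSpace ℝ (Fin d) → ℝ) : Prop where
  measurable : Measurable f
  nonneg : ∀ p, 0 ≤ f p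
  integral_eq_one : ∫ p, f p = 1
  le_const : ∀ p, f p ≤ c
  norm_fst_le : ∀ p, f p ≠ 0 → ‖p.1‖ ≤ R₁
  norm_snd_le : ∀ p, f p ≠ 0 → ‖p.2‖ ≤ R₂

/-- A Lipschitz constant in `s ∈ [0, R]` for the mass of `closedBall x s` under the spatial
marginal of a density that is bounded by `c` and has velocity support of radius `R₂`. -/
def massLip (d : ℕ) (c R₂ R : ℝ) : ℝ :=
  c * volume.real (closedBall (0 : EuclideanSpace ℝ (Fin d)) R₂) *
    (d * R ^ (d - 1) * volume.real (closedBall (0 : EuclideanSpace ℝ (Fin d)) 1))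

theorem massLip_nonneg {c R : ℝ} (hc : 0 ≤ c) (hR : 0 ≤ R) (R₂ : ℝ) :
    0 ≤ massLip d c R₂ R := by
  unfold massLip; positivity

theorem measureReal_closedBall_sub_le (x : EuclideanSpace ℝ (Fin d)) {s s' R : ℝ} (hs : 0 ≤ s)
    (hss' : s ≤ s') (hR : s' ≤ R) :
    volume.real (closedBall x s' \ closedBall x s) ≤
      d * R ^ (d - 1) * volume.real (closedBall (0 : EuclideanSpace ℝ (Fin d)) 1) * (s' - s) := by
  rw [measureReal_sdiff (closedBall_subset_closedBall hss') measurableSet_closedBall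
      measure_closedBall_lt_top.ne, Measure.addHaar_real_closedBall' _ _ hs,
    Measure.addHaar_real_closedBall' _ _ (hs.trans hss'), finrank_euclideanSpace_fin, ← sub_mul]
  have h := (le_abs_self _).trans (abs_pow_sub_pow_le s' s d)
  rw [abs_of_nonneg (sub_nonneg.2 hss'), abs_of_nonneg hs, abs_of_nonneg (hs.trans hss'),
    max_eq_left hss'] at h
  have hs' : 0 ≤ s' := hs.trans hss'
  calc _ ≤ ((s' - s) * d * s' ^ (d - 1)) *
        volume.real (closedBall (0 : EuclideanSpace ℝ (Fin d)) 1) := by gcongr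
    _ ≤ ((s' - s) * d * R ^ (d - 1)) *
        volume.real (closedBall (0 : EuclideanSpace ℝ (Fin d)) 1) := by
        have := sub_nonneg.2 hss'
        gcongr
    _ = _ := by ring

namespace IsBoundedDensity

variable {c R₁ R₂ : ℝ} {f : EuclideanSpace ℝ (Fin d) × EuclideanSpace ℝ (Fin d) → ℝ}

theorem integrable (hf : IsBoundedDensity c R₁ R₂ f) : Integrable f := by
  by_contra h
  have := hf.integral_eq_one
  rw [integral_undef h] at this
  exact zero_ne_one this

theorem const_nonneg (hf : IsBoundedDensity c R₁ R₂ f) : 0 ≤ c :=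
  (hf.nonneg 0).trans (hf.le_const 0)

theorem radius_nonneg (hf : IsBoundedDensity c R₁ R₂ f) : 0 ≤ R₁ ∧ 0 ≤ R₂ := by
  obtain ⟨p, hp⟩ : ∃ p, f p ≠ 0 := by
    by_contra! h
    have := hf.integral_eq_one
    simp [h] at this
  exact ⟨(norm_nonneg _).trans (hf.norm_fst_le p hp), (norm_nonneg _).trans (hf.norm_snd_le p hp)⟩

theorem Mdens_eq (hf : IsBoundedDensity c R₁ R₂ f) (x : EuclideanSpace ℝ (Fin d)) (s : ℝ) :
    Mdens (Smarg f) x s = ∫ p in closedBall x s ×ˢ univ, f p := by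
  rw [Measure.volume_eq_prod, setIntegral_prod _ hf.integrable.integrableOn]
  simp [Mdens, Smarg]

theorem Mdens_mem_Icc (hf : IsBoundedDensity c R₁ R₂ f) (x : EuclideanSpace ℝ (Fin d)) (s : ℝ) :
    Mdens (Smarg f) x s ∈ Icc (0 : ℝ) 1 := by
  rw [hf.Mdens_eq]
  exact ⟨integral_nonneg hf.nonneg, hf.integral_eq_one ▸
    setIntegral_le_integral hf.integrable (Eventually.of_forall hf.nonneg)⟩

theorem Mdens_mono (hf : IsBoundedDensity c R₁ R₂ f) {x x' : EuclideanSpace ℝ (Fin d)} {s s' : ℝ}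
    (h : closedBall x s ⊆ closedBall x' s') : Mdens (Smarg f) x s ≤ Mdens (Smarg f) x' s' := by
  rw [hf.Mdens_eq, hf.Mdens_eq]
  exact setIntegral_mono_set hf.integrable.integrableOn (Eventually.of_forall hf.nonneg)
    (prod_mono_left h).eventuallyLE

theorem setIntegral_prod_univ_le (hf : IsBoundedDensity c R₁ R₂ f)
    {A : Set (EuclideanSpace ℝ (Fin d))} (hA : MeasurableSet A) (hAfin : volume A ≠ ⊤) :
    ∫ p in A ×ˢ univ, f p ≤
      c * volume.real (closedBall (0 : EuclideanSpace ℝ (Fin d)) R₂) * volume.real A := by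
  have hB : MeasurableSet (A ×ˢ closedBall (0 : EuclideanSpace ℝ (Fin d)) R₂) :=
    hA.prod measurableSet_closedBall
  have hfin : volume (A ×ˢ closedBall (0 : EuclideanSpace ℝ (Fin d)) R₂) ≠ ⊤ := by
    rw [Measure.volume_eq_prod, Measure.prod_prod]
    exact ENNReal.mul_ne_top hAfin measure_closedBall_lt_top.ne
  have h : ∫ p in A ×ˢ univ, f p = ∫ p in A ×ˢ closedBall 0 R₂, f p := by
    refine setIntegral_eq_of_subset_of_forall_sdiff_eq_zero (hA.prod MeasurableSet.univ)
      (prod_mono_right (subset_univ _)) fun p hp => ?_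
    by_contra hne
    exact hp.2 ⟨hp.1.1, mem_closedBall_zero_iff.2 (hf.norm_snd_le p hne)⟩
  rw [h]
  refine (setIntegral_mono_on hf.integrable.integrableOn (integrableOn_const hfin) hB
    fun p _ => hf.le_const p).trans ?_
  rw [setIntegral_const, Measure.volume_eq_prod, measureReal_prod_prod, smul_eq_mul]
  exact (by ring : _ = _).le

theorem abs_Mdens_sub_le (hf : IsBoundedDensity c R₁ R₂ f) (x : EuclideanSpace ℝ (Fin d))
    {s s' R : ℝ} (hs : s ∈ Icc 0 R) (hs' : s' ∈ Icc 0 R) :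
    |Mdens (Smarg f) x s - Mdens (Smarg f) x s'| ≤ massLip d c R₂ R * |s - s'| := by
  wlog hss' : s' ≤ s generalizing s s'
  · rw [abs_sub_comm, abs_sub_comm s]
    exact this hs' hs (le_of_not_ge hss')
  have hsub := closedBall_subset_closedBall (x := x) hss'
  have hprod : closedBall x s ×ˢ univ \ closedBall x s' ×ˢ univ
      = (closedBall x s \ closedBall x s') ×ˢ (univ : Set (EuclideanSpace ℝ (Fin d))) := by
    ext p; simp
  rw [abs_of_nonneg (sub_nonneg.2 (hf.Mdens_mono hsub)), abs_of_nonneg (sub_nonneg.2 hss'),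
    hf.Mdens_eq, hf.Mdens_eq, ← setIntegral_sdiff (measurableSet_closedBall.prod MeasurableSet.univ)
      hf.integrable.integrableOn (prod_mono_left hsub), hprod]
  refine (hf.setIntegral_prod_univ_le (measurableSet_closedBall.diff measurableSet_closedBall)
    (measure_ne_top_of_subset sdiff_subset measure_closedBall_lt_top.ne)).trans ?_
  rw [massLip, mul_assoc _ _ (s - s')]
  exact mul_le_mul_of_nonneg_left (measureReal_closedBall_sub_le x hs'.1 hss' hs.2)
    (mul_nonneg hf.const_nonneg measureReal_nonneg)

theorem abs_Mdens_dist_sub_le (hf : IsBoundedDensity c R₁ R₂ f) {R : ℝ}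
    {x x' y : EuclideanSpace ℝ (Fin d)}
    (hx : ‖x‖ ≤ R) (hx' : ‖x'‖ ≤ R) (hy : ‖y‖ ≤ R₁) :
    |Mdens (Smarg f) x (dist x y) - Mdens (Smarg f) x' (dist x' y)| ≤
      massLip d c R₂ (3 * R + R₁) * (2 * dist x x') := by
  have hR : 0 ≤ R := (norm_nonneg _).trans hx
  have key : ∀ {x x' : EuclideanSpace ℝ (Fin d)}, ‖x‖ ≤ R → ‖x'‖ ≤ R →
      Mdens (Smarg f) x (dist x y) - Mdens (Smarg f) x' (dist x' y) ≤
        massLip d c R₂ (3 * R + R₁) * (2 * dist x x') := by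
    intro x x' hx hx'
    have h1 : dist x x' ≤ 2 * R := (dist_le_norm_add_norm _ _).trans (by linarith)
    have h2 : dist x y ≤ R + R₁ := (dist_le_norm_add_norm _ _).trans (by linarith)
    have h3 : dist x' y ≤ R + R₁ := (dist_le_norm_add_norm _ _).trans (by linarith)
    have h4 : dist x y ≤ dist x x' + dist x' y := dist_triangle _ _ _
    have h5 : dist x' y ≤ dist x x' + dist x y := dist_triangle_left _ _ _
    have h6 : (0 : ℝ) ≤ dist x x' := dist_nonneg
    have hmono := hf.Mdens_mono (x := x) (x' := x') (s := dist x y) (s' := dist x y + dist x x')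
      (closedBall_subset_closedBall' le_rfl)
    have hlip := (le_abs_self _).trans (hf.abs_Mdens_sub_le x' (R := 3 * R + R₁)
      (s := dist x y + dist x x') (s' := dist x' y) ⟨by positivity, by linarith⟩
      ⟨dist_nonneg, by linarith⟩)
    have habs : |dist x y + dist x x' - dist x' y| ≤ 2 * dist x x' :=
      abs_le.2 ⟨by linarith, by linarith⟩
    have := mul_le_mul_of_nonneg_left habs
      (massLip_nonneg (d := d) hf.const_nonneg (by linarith [hf.radius_nonneg.1] : 0 ≤ 3 * R + R₁)
        R₂)
    linarith
  refine abs_le.2 ⟨?_, key hx hx'⟩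
  have := key hx' hx
  rw [dist_comm x' x] at this
  linarith

theorem continuous_Mdens_dist (hf : IsBoundedDensity c R₁ R₂ f) (x : EuclideanSpace ℝ (Fin d)) :
    Continuous fun y => Mdens (Smarg f) x (dist x y) := by
  have h : ContinuousOn (Mdens (Smarg f) x) (Ici 0) := by
    intro s hs
    have hs1 : s < s + 1 := lt_add_one s
    have hlip : LipschitzOnWith (massLip d c R₂ (s + 1)).toNNReal (Mdens (Smarg f) x)
        (Icc 0 (s + 1)) := LipschitzOnWith.of_dist_le_mul fun u hu v hv => by
      rw [Real.coe_toNNReal _ (massLip_nonneg hf.const_nonneg (hs.trans hs1.le) R₂)]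
      exact hf.abs_Mdens_sub_le x hu hv
    refine (hlip.continuousOn s ⟨hs, hs1.le⟩).mono_of_mem_nhdsWithin ?_
    rw [← Ici_inter_Iic]
    exact inter_mem self_mem_nhdsWithin (mem_nhdsWithin_of_mem_nhds (Iic_mem_nhds hs1))
  exact h.comp_continuous (by fun_prop) fun y => dist_nonneg

theorem norm_smul_le (hf : IsBoundedDensity c R₁ R₂ f) {p : EuclideanSpace ℝ (Fin d) ×
    EuclideanSpace ℝ (Fin d)} {z : EuclideanSpace ℝ (Fin d)} {B : ℝ} (h : f p ≠ 0 → ‖z‖ ≤ B) :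
    ‖f p • z‖ ≤ f p * B := by
  rw [norm_smul, Real.norm_of_nonneg (hf.nonneg p)]
  rcases eq_or_ne (f p) 0 with h0 | h0
  · simp [h0]
  · exact mul_le_mul_of_nonneg_left (h h0) (hf.nonneg p)

theorem integrable_smul (hf : IsBoundedDensity c R₁ R₂ f)
    {g : EuclideanSpace ℝ (Fin d) × EuclideanSpace ℝ (Fin d) → EuclideanSpace ℝ (Fin d)}
    (hg : Continuous g) {B : ℝ} (hB : ∀ p, f p ≠ 0 → ‖g p‖ ≤ B) :
    Integrable fun p => f p • g p :=
  (hf.integrable.mul_const B).mono' (hf.measurable.smul hg.measurable).aestronglyMeasurable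
    (Eventually.of_forall fun p => hf.norm_smul_le (hB p))

theorem norm_integral_smul_le (hf : IsBoundedDensity c R₁ R₂ f)
    {g : EuclideanSpace ℝ (Fin d) × EuclideanSpace ℝ (Fin d) → EuclideanSpace ℝ (Fin d)}
    {B : ℝ} (hB : ∀ p, f p ≠ 0 → ‖g p‖ ≤ B) : ‖∫ p, f p • g p‖ ≤ B := by
  refine (norm_integral_le_of_norm_le (hf.integrable.mul_const B)
    (Eventually.of_forall fun p => hf.norm_smul_le (hB p))).trans ?_
  rw [integral_mul_const, hf.integral_eq_one, one_mul]

variable {K : ℝ → ℝ}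

theorem abs_kernel_le (hf : IsBoundedDensity c R₁ R₂ f)
    (hK : ∀ z ∈ Icc (0 : ℝ) 1, |K z| ≤ K 0) (x : EuclideanSpace ℝ (Fin d)) (s : ℝ) :
    |K (Mdens (Smarg f) x s)| ≤ K 0 :=
  hK _ (hf.Mdens_mem_Icc x s)

theorem continuous_kernel (hf : IsBoundedDensity c R₁ R₂ f) (hK : ContinuousOn K (Icc 0 1))
    (x : EuclideanSpace ℝ (Fin d)) :
    Continuous fun y => K (Mdens (Smarg f) x (dist x y)) :=
  hK.comp_continuous (hf.continuous_Mdens_dist x) fun _ => hf.Mdens_mem_Icc _ _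

theorem norm_snd_sub_le (hf : IsBoundedDensity c R₁ R₂ f) (v : EuclideanSpace ℝ (Fin d))
    {p : EuclideanSpace ℝ (Fin d) × EuclideanSpace ℝ (Fin d)} (hp : f p ≠ 0) :
    ‖p.2 - v‖ ≤ R₂ + ‖v‖ :=
  (norm_sub_le _ _).trans (add_le_add_left (hf.norm_snd_le p hp) _)

theorem norm_kernel_smul_le (hf : IsBoundedDensity c R₁ R₂ f)
    (hK : ∀ z ∈ Icc (0 : ℝ) 1, |K z| ≤ K 0) (x v : EuclideanSpace ℝ (Fin d))
    {p : EuclideanSpace ℝ (Fin d) × EuclideanSpace ℝ (Fin d)} (hp : f p ≠ 0) :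
    ‖K (Mdens (Smarg f) x (dist x p.1)) • (p.2 - v)‖ ≤ K 0 * (R₂ + ‖v‖) := by
  rw [norm_smul]
  exact mul_le_mul (hf.abs_kernel_le hK x _) (hf.norm_snd_sub_le v hp) (norm_nonneg _)
    ((abs_nonneg _).trans (hf.abs_kernel_le hK x 0))

end IsBoundedDensity

theorem Wfield_eq_integral_smul (K : ℝ → ℝ) (ρ : EuclideanSpace ℝ (Fin d) → ℝ)
    (f : EuclideanSpace ℝ (Fin d) × EuclideanSpace ℝ (Fin d) → ℝ)
    (x v : EuclideanSpace ℝ (Fin d)) :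
    Wfield K ρ f x v = ∫ p, f p • K (Mdens ρ x (dist x p.1)) • (p.2 - v) := by
  simp only [Wfield, smul_smul, mul_comm]

namespace IsBoundedDensity

variable {c R₁ R₂ : ℝ} {f : EuclideanSpace ℝ (Fin d) × EuclideanSpace ℝ (Fin d) → ℝ} {K : ℝ → ℝ}

theorem norm_Wfield_le (hf : IsBoundedDensity c R₁ R₂ f)
    (hK : ∀ z ∈ Icc (0 : ℝ) 1, |K z| ≤ K 0) (x v : EuclideanSpace ℝ (Fin d)) :
    ‖Wfield K (Smarg f) f x v‖ ≤ K 0 * (R₂ + ‖v‖) := by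
  rw [Wfield_eq_integral_smul]
  exact hf.norm_integral_smul_le fun p hp => hf.norm_kernel_smul_le hK x v hp

theorem norm_Wfield_sub_le (hf : IsBoundedDensity c R₁ R₂ f)
    (hK : ∀ z ∈ Icc (0 : ℝ) 1, |K z| ≤ K 0) {LK : ℝ≥0} (hKlip : LipschitzOnWith LK K (Icc 0 1))
    {R : ℝ} {x x' : EuclideanSpace ℝ (Fin d)} (hx : ‖x‖ ≤ R) (hx' : ‖x'‖ ≤ R)
    (v v' : EuclideanSpace ℝ (Fin d)) :
    ‖Wfield K (Smarg f) f x v - Wfield K (Smarg f) f x' v'‖ ≤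
      LK * (massLip d c R₂ (3 * R + R₁) * (2 * dist x x')) * (R₂ + ‖v‖) + K 0 * ‖v - v'‖ := by
  have hint : ∀ x v : EuclideanSpace ℝ (Fin d),
      Integrable fun p => f p • K (Mdens (Smarg f) x (dist x p.1)) • (p.2 - v) := fun x v =>
    hf.integrable_smul (((hf.continuous_kernel hKlip.continuousOn x).comp continuous_fst).smul
      (by fun_prop)) fun p hp => hf.norm_kernel_smul_le hK x v hp
  rw [Wfield_eq_integral_smul, Wfield_eq_integral_smul, ← integral_sub (hint x v) (hint x' v')]
  simp only [← smul_sub]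
  refine hf.norm_integral_smul_le fun p hp => ?_
  set k := K (Mdens (Smarg f) x (dist x p.1))
  set k' := K (Mdens (Smarg f) x' (dist x' p.1))
  have hk : |k - k'| ≤ LK * (massLip d c R₂ (3 * R + R₁) * (2 * dist x x')) :=
    (hKlip.dist_le_mul _ (hf.Mdens_mem_Icc _ _) _ (hf.Mdens_mem_Icc _ _)).trans
      (mul_le_mul_of_nonneg_left (hf.abs_Mdens_dist_sub_le hx hx' (hf.norm_fst_le p hp)) LK.2)
  have key : k • (p.2 - v) - k' • (p.2 - v') = (k - k') • (p.2 - v) + k' • (v' - v) := by module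
  rw [key]
  refine (norm_add_le _ _).trans (add_le_add ?_ ?_)
  · rw [norm_smul]
    exact mul_le_mul hk (hf.norm_snd_sub_le v hp) (norm_nonneg _) ((abs_nonneg _).trans hk)
  · rw [norm_smul, norm_sub_rev v' v]
    exact mul_le_mul_of_nonneg_right (hf.abs_kernel_le hK _ _) (norm_nonneg _)

theorem mollified_Mdens_bounds (hf : IsBoundedDensity c R₁ R₂ f) (x : EuclideanSpace ℝ (Fin d))
    {s ε : ℝ} (hs : 0 ≤ s) (hε : 0 < ε) (hε1 : ε ≤ 1) :
    Mdens (Smarg f) x s ≤ ∫ p, radialCutoff (ε⁻¹ * s) (ε⁻¹ • (p.1 - x)) * f p ∧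
      ∫ p, radialCutoff (ε⁻¹ * s) (ε⁻¹ • (p.1 - x)) * f p ≤
        Mdens (Smarg f) x s + massLip d c R₂ (s + 1) * ε := by
  have hnorm : ∀ z : EuclideanSpace ℝ (Fin d), ‖ε⁻¹ • z‖ = ε⁻¹ * ‖z‖ := fun z => by
    rw [norm_smul, Real.norm_of_nonneg (inv_nonneg.2 hε.le)]
  have hint : Integrable fun p : EuclideanSpace ℝ (Fin d) × EuclideanSpace ℝ (Fin d) =>
      radialCutoff (ε⁻¹ * s) (ε⁻¹ • (p.1 - x)) * f p := by
    refine hf.integrable.mono' (Measurable.mul ?_ hf.measurable).aestronglyMeasurable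
      (Eventually.of_forall fun p => ?_)
    · exact ((continuous_radialCutoff _).comp (by fun_prop)).measurable
    · rw [norm_mul, Real.norm_of_nonneg (radialCutoff_nonneg _ _),
        Real.norm_of_nonneg (hf.nonneg p)]
      exact mul_le_of_le_one_left (hf.nonneg p) (radialCutoff_le_one _ _)
  have hmeas : ∀ u, MeasurableSet (closedBall x u ×ˢ (univ : Set (EuclideanSpace ℝ (Fin d)))) :=
    fun u => measurableSet_closedBall.prod MeasurableSet.univ
  constructor
  · rw [hf.Mdens_eq, ← integral_indicator (hmeas _)]
    refine integral_mono (hf.integrable.indicator (hmeas _)) hint fun p => ?_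
    refine indicator_apply_le' (fun hp => ?_) fun _ =>
      mul_nonneg (radialCutoff_nonneg _ _) (hf.nonneg p)
    rw [radialCutoff_eq_one, one_mul]
    rw [hnorm, ← dist_eq_norm]
    exact mul_le_mul_of_nonneg_left hp.1 (inv_nonneg.2 hε.le)
  · have hle : ∫ p, radialCutoff (ε⁻¹ * s) (ε⁻¹ • (p.1 - x)) * f p ≤
        Mdens (Smarg f) x (s + ε) := by
      rw [hf.Mdens_eq, ← integral_indicator (hmeas _)]
      refine integral_mono hint (hf.integrable.indicator (hmeas _)) fun p => ?_
      refine le_indicator_apply (fun _ => ?_) fun hp => ?_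
      · exact mul_le_of_le_one_left (hf.nonneg p) (radialCutoff_le_one _ _)
      · have hp' : s + ε ≤ ‖p.1 - x‖ := by
          rw [← dist_eq_norm]
          by_contra! h
          exact hp ⟨h.le, mem_univ _⟩
        rw [radialCutoff_eq_zero, zero_mul]
        rw [hnorm]
        calc ε⁻¹ * s + 1 = ε⁻¹ * (s + ε) := by field_simp
          _ ≤ _ := mul_le_mul_of_nonneg_left hp' (inv_nonneg.2 hε.le)
    have hlip := (le_abs_self _).trans (hf.abs_Mdens_sub_le x (R := s + 1) (s := s + ε) (s' := s)
      ⟨by positivity, by linarith⟩ ⟨hs, by linarith⟩)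
    rw [add_sub_cancel_left, abs_of_pos hε] at hlip
    linarith

end IsBoundedDensity

/-- Weak continuity in time, tested against bounded continuous functions. -/
def WeaklyContinuousOn (f : ℝ → EuclideanSpace ℝ (Fin d) × EuclideanSpace ℝ (Fin d) → ℝ)
    (S : Set ℝ) : Prop :=
  ∀ α : EuclideanSpace ℝ (Fin d) × EuclideanSpace ℝ (Fin d) → ℝ,
    Continuous α → (∃ C : ℝ, ∀ p, |α p| ≤ C) → ContinuousOn (fun t => ∫ p, α p * f t p) S

namespace WeaklyContinuousOn

variable {f : ℝ → EuclideanSpace ℝ (Fin d) × EuclideanSpace ℝ (Fin d) → ℝ} {S : Set ℝ} {s : ℝ}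
  {c R₁ R₂ : ℝ}

theorem continuousWithinAt_integral_smul (hweak : WeaklyContinuousOn f S) (hs : s ∈ S)
    (hf : ∀ t ∈ S, Integrable (f t))
    {α : EuclideanSpace ℝ (Fin d) × EuclideanSpace ℝ (Fin d) → EuclideanSpace ℝ (Fin d)}
    (hα : Continuous α) {C : ℝ} (hC : ∀ p, ‖α p‖ ≤ C) :
    ContinuousWithinAt (fun t => ∫ p, f t p • α p) S s := by
  have hint : ∀ t ∈ S, Integrable fun p => f t p • α p := fun t ht =>
    (hf t ht).smul_bdd C hα.aestronglyMeasurable (Eventually.of_forall hC)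
  have hcoord : ∀ i t, t ∈ S → (∫ p, f t p • α p) i = ∫ p, α p i * f t p := fun i t ht => by
    rw [eval_integral_piLp fun i => (hint t ht).eval_piLp i]
    simp [mul_comm]
  have hofLp : ContinuousWithinAt (fun t i => (∫ p, f t p • α p) i) S s := by
    rw [continuousWithinAt_pi]
    intro i
    refine (hweak (fun p => α p i) (by fun_prop)
      ⟨C, fun p => (PiLp.norm_apply_le (α p) i).trans (hC p)⟩ s hs).congr
      (fun t ht => hcoord i t ht) (hcoord i s hs)
  exact (PiLp.continuous_toLp 2 _).continuousAt.comp_continuousWithinAt hofLp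

theorem continuousWithinAt_Mdens (hweak : WeaklyContinuousOn f S) (hs : s ∈ S)
    (hf : ∀ᶠ t in 𝓝[S] s, IsBoundedDensity c R₁ R₂ (f t)) (x : EuclideanSpace ℝ (Fin d))
    {u : ℝ} (hu : 0 ≤ u) :
    ContinuousWithinAt (fun t => Mdens (Smarg (f t)) x u) S s := by
  have hfs := hf.self_of_nhdsWithin hs
  rw [ContinuousWithinAt, Metric.tendsto_nhds]
  intro η hη
  have hL := massLip_nonneg (d := d) hfs.const_nonneg (by positivity : 0 ≤ u + 1) R₂
  set L := massLip d c R₂ (u + 1)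
  obtain ⟨ε, hε, hε1, hεL⟩ : ∃ ε : ℝ, 0 < ε ∧ ε ≤ 1 ∧ L * ε ≤ η / 2 := by
    refine ⟨min 1 (η / (2 * (L + 1))), by positivity, min_le_left _ _, ?_⟩
    calc L * min 1 (η / (2 * (L + 1))) ≤ (L + 1) * (η / (2 * (L + 1))) :=
          mul_le_mul (by linarith) (min_le_right _ _) (by positivity) (by positivity)
      _ = η / 2 := by field_simp
  have hφ := hweak (fun p => radialCutoff (ε⁻¹ * u) (ε⁻¹ • (p.1 - x)))
    ((continuous_radialCutoff _).comp (by fun_prop)) ⟨1, fun p => by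
      rw [abs_of_nonneg (radialCutoff_nonneg _ _)]
      exact radialCutoff_le_one _ _⟩ s hs
  filter_upwards [Metric.tendsto_nhds.1 hφ (η / 2) (half_pos hη), hf] with t ht hft
  obtain ⟨h1, h2⟩ := hft.mollified_Mdens_bounds x hu hε hε1
  obtain ⟨h3, h4⟩ := hfs.mollified_Mdens_bounds x hu hε hε1
  rw [Real.dist_eq, abs_lt] at ht ⊢
  exact ⟨by linarith [ht.1], by linarith [ht.2]⟩

theorem continuousWithinAt_Wfield (hweak : WeaklyContinuousOn f S) (hs : s ∈ S)
    (hint : ∀ t ∈ S, Integrable (f t))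
    (hf : ∀ᶠ t in 𝓝[S] s, IsBoundedDensity c R₁ R₂ (f t))
    {K : ℝ → ℝ} (hK : ∀ z ∈ Icc (0 : ℝ) 1, |K z| ≤ K 0) (hKc : ContinuousOn K (Icc 0 1))
    (x v : EuclideanSpace ℝ (Fin d)) :
    ContinuousWithinAt (fun t => Wfield K (Smarg (f t)) (f t) x v) S s := by
  have hfs := hf.self_of_nhdsWithin hs
  have hK0 : 0 ≤ K 0 := (abs_nonneg _).trans (hfs.abs_kernel_le hK x 0)
  have hR₂ := hfs.radius_nonneg.2
  have hc := hfs.const_nonneg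
  set κ : ℝ → EuclideanSpace ℝ (Fin d) → ℝ := fun t y => K (Mdens (Smarg (f t)) x (dist x y))
  have hκs : Continuous (κ s) := hfs.continuous_kernel hKc x
  set α : EuclideanSpace ℝ (Fin d) × EuclideanSpace ℝ (Fin d) → EuclideanSpace ℝ (Fin d) :=
    fun p => κ s p.1 • (radialCutoff R₂ p.2 • p.2 - v)
  have hαc : Continuous α := (hκs.comp continuous_fst).smul
    ((((continuous_radialCutoff R₂).comp continuous_snd).smul continuous_snd).sub
      continuous_const)
  have hαb : ∀ p, ‖α p‖ ≤ K 0 * (R₂ + 1 + ‖v‖) := fun p => by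
    rw [norm_smul]
    exact mul_le_mul (hfs.abs_kernel_le hK x _) ((norm_sub_le _ _).trans
      (add_le_add_left (norm_radialCutoff_smul_self_le hR₂ _) _)) (norm_nonneg _) hK0
  have hfrozen := hweak.continuousWithinAt_integral_smul hs hint hαc hαb
  set B : Set (EuclideanSpace ℝ (Fin d) × EuclideanSpace ℝ (Fin d)) :=
    closedBall 0 R₁ ×ˢ closedBall 0 R₂
  have hB : MeasurableSet B := measurableSet_closedBall.prod measurableSet_closedBall
  have hBfin : volume B ≠ ⊤ :=
    ((isCompact_closedBall _ _).prod (isCompact_closedBall _ _)).measure_lt_top.ne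
  set D : ℝ → EuclideanSpace ℝ (Fin d) × EuclideanSpace ℝ (Fin d) → ℝ := fun t =>
    B.indicator fun p => |κ t p.1 - κ s p.1| * (c * (R₂ + ‖v‖))
  have hDmeas : ∀ᶠ t in 𝓝[S] s, AEStronglyMeasurable (D t) volume := by
    filter_upwards [hf] with t ht
    have hκt : Continuous (κ t) := ht.continuous_kernel hKc x
    have : Continuous fun p : EuclideanSpace ℝ (Fin d) × EuclideanSpace ℝ (Fin d) =>
      |κ t p.1 - κ s p.1| * (c * (R₂ + ‖v‖)) := by fun_prop
    exact (this.measurable.indicator hB).aestronglyMeasurable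
  have hDbound : ∀ᶠ t in 𝓝[S] s, ∀ p,
      ‖D t p‖ ≤ B.indicator (fun _ => (K 0 + K 0) * (c * (R₂ + ‖v‖))) p := by
    filter_upwards [hf] with t ht p
    rw [norm_indicator_eq_indicator_norm]
    refine indicator_le_indicator ?_
    rw [norm_mul, Real.norm_of_nonneg (by positivity : 0 ≤ c * (R₂ + ‖v‖)), Real.norm_eq_abs,
      abs_abs]
    exact mul_le_mul_of_nonneg_right ((abs_sub _ _).trans
      (add_le_add (ht.abs_kernel_le hK x _) (hfs.abs_kernel_le hK x _))) (by positivity)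
  have hD : Tendsto (fun t => ∫ p, D t p) (𝓝[S] s) (𝓝 0) := by
    have := tendsto_integral_filter_of_dominated_convergence (f := fun _ => (0 : ℝ)) _ hDmeas
      (hDbound.mono fun t ht => Eventually.of_forall ht)
      ((integrableOn_const hBfin).integrable_indicator hB) (Eventually.of_forall fun p => ?_)
    · simpa using this
    · have hM : Tendsto (fun t => Mdens (Smarg (f t)) x (dist x p.1)) (𝓝[S] s)
          (𝓝[Icc 0 1] (Mdens (Smarg (f s)) x (dist x p.1))) :=
        tendsto_nhdsWithin_iff.2 ⟨hweak.continuousWithinAt_Mdens hs hf x dist_nonneg,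
          hf.mono fun t ht => ht.Mdens_mem_Icc _ _⟩
      have hκ : Tendsto (fun t => κ t p.1) (𝓝[S] s) (𝓝 (κ s p.1)) :=
        (hKc _ (hfs.Mdens_mem_Icc _ _)).tendsto.comp hM
      have h0 : Tendsto (fun t => |κ t p.1 - κ s p.1| * (c * (R₂ + ‖v‖))) (𝓝[S] s) (𝓝 0) := by
        simpa using ((hκ.sub_const (κ s p.1)).abs.mul_const (c * (R₂ + ‖v‖)))
      by_cases hp : p ∈ B
      · simpa [D, hp] using h0
      · simpa only [D, indicator_of_notMem hp] using tendsto_const_nhds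
  have hdiff : ∀ᶠ t in 𝓝[S] s,
      ‖Wfield K (Smarg (f t)) (f t) x v - ∫ p, f t p • α p‖ ≤ ∫ p, D t p := by
    filter_upwards [hf, hDmeas, hDbound] with t ht hmt hbt
    have hα : ∫ p, f t p • α p = ∫ p, f t p • κ s p.1 • (p.2 - v) := by
      refine integral_congr_ae (Eventually.of_forall fun p => ?_)
      rcases eq_or_ne (f t p) 0 with h0 | h0
      · simp [h0]
      · simp only [α, radialCutoff_eq_one (ht.norm_snd_le p h0), one_smul]
    have hi : ∀ k : EuclideanSpace ℝ (Fin d) → ℝ, Continuous k → (∀ y, |k y| ≤ K 0) →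
        Integrable fun p => f t p • k p.1 • (p.2 - v) := fun k hk hkb =>
      ht.integrable_smul (B := K 0 * (R₂ + ‖v‖)) ((hk.comp continuous_fst).smul (by fun_prop))
        fun p hp => by
          rw [norm_smul]
          exact mul_le_mul (hkb _) (ht.norm_snd_sub_le v hp) (norm_nonneg _) hK0
    rw [hα, Wfield_eq_integral_smul, ← integral_sub
      (hi (κ t) (ht.continuous_kernel hKc x) fun y => ht.abs_kernel_le hK x _)
      (hi (κ s) hκs fun y => hfs.abs_kernel_le hK x _)]
    refine norm_integral_le_of_norm_le
      (((integrableOn_const hBfin).integrable_indicator hB).mono' hmt (Eventually.of_forall hbt))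
      (Eventually.of_forall fun p => ?_)
    rw [← smul_sub, ← sub_smul]
    rcases eq_or_ne (f t p) 0 with h0 | h0
    · rw [h0, zero_smul, norm_zero]
      exact indicator_nonneg (fun _ _ => by positivity) _
    · have hp : p ∈ B := ⟨mem_closedBall_zero_iff.2 (ht.norm_fst_le p h0),
        mem_closedBall_zero_iff.2 (ht.norm_snd_le p h0)⟩
      simp only [D, indicator_of_mem hp]
      rw [norm_smul, norm_smul, Real.norm_of_nonneg (ht.nonneg p), Real.norm_eq_abs,
        mul_left_comm]
      exact mul_le_mul_of_nonneg_left (mul_le_mul (ht.le_const p) (ht.norm_snd_sub_le v h0)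
        (norm_nonneg _) hc) (abs_nonneg _)
  have hWs : Wfield K (Smarg (f s)) (f s) x v = ∫ p, f s p • α p := by
    have := hdiff.self_of_nhdsWithin hs
    simpa [D, sub_eq_zero] using this
  have hlim := hfrozen.tendsto.add (squeeze_zero_norm' hdiff hD)
  rw [ContinuousWithinAt, hWs]
  simpa using hlim

end WeaklyContinuousOn

end MeanField

/-- Let `{f_t}_{t≥0}` be a weakly continuous family of bounded
probability densities, with `‖f_t‖_∞ ≤ r(t)` and `supp f_t ⊂ B_{R_x(t)} × B_{R_v(t)}`
for continuous non-decreasing `r, R_x, R_v`. Then for any `(x,v)` the characteristic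
system `Ẋ = V`, `V̇ = W[Sf_t,f_t](X,V)`, `X₀ = x`, `V₀ = v` has a unique global
solution on `[0,∞)`. -/
theorem characteristics_global_wellposedness {d : ℕ} (K : ℝ → ℝ)
    (hKpos : ∀ z ∈ Set.Icc (0:ℝ) 1, 0 < K z)
    (hKanti : AntitoneOn K (Set.Icc (0:ℝ) 1))
    (LK : NNReal) (hKlip : LipschitzOnWith LK K (Set.Icc (0:ℝ) 1))
    (f : ℝ → EuclideanSpace ℝ (Fin d) × EuclideanSpace ℝ (Fin d) → ℝ)
    (r Rx Rv : ℝ → ℝ)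
    (hr : Continuous r) (hrmono : Monotone r)
    (hRx : Continuous Rx) (hRxmono : Monotone Rx)
    (hRv : Continuous Rv) (hRvmono : Monotone Rv)
    (hdens : ∀ t : ℝ, 0 ≤ t → Measurable (f t) ∧ (∀ p, 0 ≤ f t p) ∧ (∫ p, f t p) = 1)
    (hbdd : ∀ t : ℝ, 0 ≤ t → ∀ p, f t p ≤ r t)
    (hsupp : ∀ t : ℝ, 0 ≤ t → ∀ p, f t p ≠ 0 →
      p ∈ closedBall (0 : EuclideanSpace ℝ (Fin d)) (Rx t) ×ˢ
        closedBall (0 : EuclideanSpace ℝ (Fin d)) (Rv t))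
    (hweakcont : ∀ α : EuclideanSpace ℝ (Fin d) × EuclideanSpace ℝ (Fin d) → ℝ,
      Continuous α → (∃ C : ℝ, ∀ p, |α p| ≤ C) →
      ContinuousOn (fun t => ∫ p, α p * f t p) (Set.Ici 0)) :
    ∀ x v : EuclideanSpace ℝ (Fin d),
      ∃ Z : ℝ → EuclideanSpace ℝ (Fin d) × EuclideanSpace ℝ (Fin d),
        Z 0 = (x, v) ∧
        (∀ t ∈ Set.Ici (0:ℝ),
          HasDerivWithinAt (fun τ => (Z τ).1) ((Z t).2) (Set.Ici 0) t ∧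
          HasDerivWithinAt (fun τ => (Z τ).2)
            (Wfield K (Smarg (f t)) (f t) (Z t).1 (Z t).2) (Set.Ici 0) t) ∧
        ∀ Z' : ℝ → EuclideanSpace ℝ (Fin d) × EuclideanSpace ℝ (Fin d),
          Z' 0 = (x, v) →
          (∀ t ∈ Set.Ici (0:ℝ),
            HasDerivWithinAt (fun τ => (Z' τ).1) ((Z' t).2) (Set.Ici 0) t ∧
            HasDerivWithinAt (fun τ => (Z' τ).2)
              (Wfield K (Smarg (f t)) (f t) (Z' t).1 (Z' t).2) (Set.Ici 0) t) →
          ∀ t ∈ Set.Ici (0:ℝ), Z' t = Z t := by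
  intro x v
  have hdensity : ∀ T, ∀ t ∈ Icc 0 T, IsBoundedDensity (r T) (Rx T) (Rv T) (f t) :=
    fun T t ht => by
      obtain ⟨hm, hn, hi⟩ := hdens t ht.1
      exact ⟨hm, hn, hi, fun p => (hbdd t ht.1 p).trans (hrmono ht.2),
        fun p hp => (mem_closedBall_zero_iff.1 (hsupp t ht.1 p hp).1).trans (hRxmono ht.2),
        fun p hp => (mem_closedBall_zero_iff.1 (hsupp t ht.1 p hp).2).trans (hRvmono ht.2)⟩
  have hK : ∀ z ∈ Icc (0 : ℝ) 1, |K z| ≤ K 0 := fun z hz => by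
    rw [abs_of_pos (hKpos z hz)]
    exact hKanti (left_mem_Icc.2 zero_le_one) hz hz.1
  have hK0 : 0 ≤ K 0 := (hKpos 0 (left_mem_Icc.2 zero_le_one)).le
  have hweak : WeaklyContinuousOn f (Ici 0) := hweakcont
  let F : ℝ → EuclideanSpace ℝ (Fin d) × EuclideanSpace ℝ (Fin d) →
      EuclideanSpace ℝ (Fin d) × EuclideanSpace ℝ (Fin d) :=
    fun t z => (z.2, Wfield K (Smarg (f t)) (f t) z.1 z.2)
  have hcont : ∀ z, ContinuousOn (fun t => F t z) (Ici 0) := fun z s hs => by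
    refine continuousWithinAt_const.prodMk (hweak.continuousWithinAt_Wfield (c := r (s + 1))
      (R₁ := Rx (s + 1)) (R₂ := Rv (s + 1)) hs
      (fun t ht => (hdensity t t ⟨ht, le_rfl⟩).integrable) ?_ hK hKlip.continuousOn z.1 z.2)
    filter_upwards [self_mem_nhdsWithin,
      mem_nhdsWithin_of_mem_nhds (Iic_mem_nhds (lt_add_one s))] with t ht0 ht1
    exact hdensity (s + 1) t ⟨ht0, ht1⟩
  have hlip : ∀ T R : ℝ, 0 ≤ R →
      ∃ L : NNReal, ∀ t ∈ Icc 0 T, LipschitzOnWith L (F t) (closedBall 0 R) := fun T R hR => by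
    let L := LK * (massLip d (r T) (Rv T) (3 * R + Rx T) * 2) * (Rv T + R)
    refine ⟨1 + (L + K 0).toNNReal, fun t ht => LipschitzOnWith.of_dist_le_mul fun z hz w hw => ?_⟩
    have hft := hdensity T t ht
    have hz' := mem_closedBall_zero_iff.1 hz
    have hw' := mem_closedBall_zero_iff.1 hw
    have hML : 0 ≤ massLip d (r T) (Rv T) (3 * R + Rx T) :=
      massLip_nonneg hft.const_nonneg (by linarith [hft.radius_nonneg.1]) _
    have hRvT := hft.radius_nonneg.2
    have hL : 0 ≤ L + K 0 := by positivity
    have h1 : dist z.1 w.1 ≤ dist z w := le_max_left _ _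
    have h2 : dist z.2 w.2 ≤ dist z w := le_max_right _ _
    have hW : dist (F t z).2 (F t w).2 ≤ (L + K 0) * dist z w := by
      rw [dist_eq_norm]
      refine (hft.norm_Wfield_sub_le hK hKlip ((norm_fst_le z).trans hz')
        ((norm_fst_le w).trans hw') z.2 w.2).trans ?_
      rw [← dist_eq_norm z.2, add_mul]
      refine add_le_add ?_ (mul_le_mul_of_nonneg_left h2 hK0)
      calc _ ≤ LK * (massLip d (r T) (Rv T) (3 * R + Rx T) * (2 * dist z w)) * (Rv T + R) := by
            gcongr
            exact (norm_snd_le z).trans hz'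
        _ = L * dist z w := by simp only [L]; ring
    rw [NNReal.coe_add, NNReal.coe_one, Real.coe_toNNReal _ hL, add_mul, one_mul]
    exact max_le (h2.trans (le_add_of_nonneg_right (mul_nonneg hL dist_nonneg)))
      (hW.trans (le_add_of_nonneg_left dist_nonneg))
  have hgrow : ∀ T : ℝ, ∃ C : ℝ, 0 ≤ C ∧ ∀ t ∈ Icc 0 T, ∀ z, ‖F t z‖ ≤ C * ‖z‖ + C := fun T => by
    refine ⟨1 + K 0 + K 0 * |Rv T|, by positivity, fun t ht z => ?_⟩
    have hft := hdensity T t ht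
    have h2 : ‖z.2‖ ≤ ‖z‖ := norm_snd_le z
    have hnn := norm_nonneg z
    have hKR : 0 ≤ K 0 * |Rv T| := by positivity
    refine max_le ?_ ((hft.norm_Wfield_le hK z.1 z.2).trans ?_)
    · change ‖z.2‖ ≤ _
      nlinarith
    · calc K 0 * (Rv T + ‖z.2‖) ≤ K 0 * (|Rv T| + ‖z‖) := by
            gcongr
            exact le_abs_self _
        _ ≤ _ := by nlinarith
  have hsplit : ∀ (Z : ℝ → EuclideanSpace ℝ (Fin d) × EuclideanSpace ℝ (Fin d)) (t : ℝ),
      HasDerivWithinAt Z (F t (Z t)) (Ici 0) t ↔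
        HasDerivWithinAt (fun τ => (Z τ).1) ((Z t).2) (Ici 0) t ∧
        HasDerivWithinAt (fun τ => (Z τ).2)
          (Wfield K (Smarg (f t)) (f t) (Z t).1 (Z t).2) (Ici 0) t := fun Z t =>
    ⟨fun h => ⟨h.hasFDerivWithinAt.fst.hasDerivWithinAt.congr_deriv (by simp [F]),
      h.hasFDerivWithinAt.snd.hasDerivWithinAt.congr_deriv (by simp [F])⟩,
      fun h => h.1.prodMk h.2⟩
  obtain ⟨Z, hZ0, hZ, huniq⟩ := existsUnique_global_of_linear_growth hcont hlip hgrow (x, v)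
  exact ⟨Z, hZ0, fun t ht => (hsplit Z t).1 (hZ t ht), fun Z' hZ'0 hZ' =>
    huniq Z' hZ'0 fun t ht => (hsplit Z' t).2 (hZ' t ht)⟩
end
end
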